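/- arXiv:2002.01388 — 3 statements merged into one kernel-verified Lean document; each statement's English description precedes it below -/
import Mathlib

section
/- Let G be a group, let T be a G-tree, let x be a point of T, let d be a direction at x (a connected component of T minus {x}), and let g be an element of G. If the image gd is properly contained in d, then g is loxodromic in T and the segment [x, gx] is contained in Axis_T(g). -/
noncomputable section

open Metric Set

universe u v

/-- A geodesic metric space: any two points are joined by an isometrically
parametrized segment. -/
def GeodesicSpace (Y : Type*) [MetricSpace Y] : Prop :=
  ∀ x y : Y, ∃ f : ℝ → Y, f 0 = x ∧ f (dist x y) = y ∧
    ∀ s ∈ Set.Icc (0:ℝ) (dist x y), ∀ t ∈ Set.Icc (0:ℝ) (dist x y),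
      dist (f s) (f t) = |s - t|

/-- Gromov hyperbolicity (four-point condition) with constant `δ`. -/
def GromovHyperbolic (Y : Type*) [MetricSpace Y] (δ : ℝ) : Prop :=
  ∀ x y z w : Y, dist x y + dist z w ≤ max (dist x z + dist y w) (dist x w + dist y z) + 2 * δ

/-- A Gromov hyperbolic geodesic metric space. -/
def HyperbolicGeodesicSpace (Y : Type*) [MetricSpace Y] : Prop :=
  GeodesicSpace Y ∧ ∃ δ : ℝ, 0 ≤ δ ∧ GromovHyperbolic Y δ

/-- An isometric action `ρ` of `G` on `Y` is acylindrical if for every `R > 0` there are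
`L > 0` and `N` such that for any two points at distance `> L`, at most `N` elements of `G`
move both points by less than `R`. -/
def IsAcylindrical {G : Type*} [Group G] {Y : Type*} [MetricSpace Y] (ρ : G →* (Y ≃ᵢ Y)) : Prop :=
  ∀ R : ℝ, 0 < R → ∃ L : ℝ, 0 < L ∧ ∃ N : ℕ, ∀ x y : Y, L < dist x y →
    ∃ s : Finset G, s.card ≤ N ∧
      ∀ g : G, dist x (ρ g x) < R → dist y (ρ g y) < R → g ∈ s

/-- A group is virtually cyclic if it has a cyclic subgroup of finite index. -/
def VirtuallyCyclic (G : Type*) [Group G] : Prop :=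
  ∃ H : Subgroup G, H.FiniteIndex ∧ IsCyclic ↥H

/-- A group is acylindrically hyperbolic if it is not virtually cyclic and admits an
acylindrical isometric action with unbounded orbits on a Gromov hyperbolic geodesic space
(this is equivalent to admitting a nonelementary acylindrical action on such a space). -/
def AcylindricallyHyperbolic (G : Type u) [Group G] : Prop :=
  ¬ VirtuallyCyclic G ∧
    ∃ (Y : Type u) (_ : MetricSpace Y) (ρ : G →* (Y ≃ᵢ Y)),
      HyperbolicGeodesicSpace Y ∧ IsAcylindrical ρ ∧
      ∃ y : Y, ¬ Bornology.IsBounded (Set.range fun g : G => ρ g y)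

/-- The metric segment between `x` and `y`; in a real tree this is the unique arc
joining `x` to `y`. -/
def seg {T : Type*} [MetricSpace T] (x y : T) : Set T :=
  {z : T | dist x z + dist z y = dist x y}

/-- `A` is a (parametrized) arc from `x` to `y`. -/
def IsArcBetween {T : Type*} [MetricSpace T] (x y : T) (A : Set T) : Prop :=
  ∃ f : ℝ → T, ContinuousOn f (Set.Icc 0 1) ∧ Set.InjOn f (Set.Icc 0 1) ∧
    f 0 = x ∧ f 1 = y ∧ A = f '' Set.Icc 0 1

/-- A real tree: a geodesic metric space in which every pair of points is joined by a
unique arc. -/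
def IsRealTree (T : Type*) [MetricSpace T] : Prop :=
  GeodesicSpace T ∧
    ∀ (x y : T) (A B : Set T), IsArcBetween x y A → IsArcBetween x y B → A = B

section TreeAction

variable {G : Type*} [Group G] {T : Type*} [MetricSpace T]

/-- Translation length of `g` for the action `ρ`. -/
def transLen (ρ : G →* (T ≃ᵢ T)) (g : G) : ℝ := ⨅ x : T, dist x (ρ g x)

/-- The characteristic set of `g`: the set of points minimally displaced by `g`.
For an elliptic element this is its fixed-point set, and for a loxodromic element
this is its axis. -/
def charSet (ρ : G →* (T ≃ᵢ T)) (g : G) : Set T :=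
  {x : T | dist x (ρ g x) = transLen ρ g}

/-- `g` is elliptic: it fixes a point. -/
def Elliptic (ρ : G →* (T ≃ᵢ T)) (g : G) : Prop := ∃ x : T, ρ g x = x

/-- `A` is an axis for `g`: an invariant isometric copy of `ℝ` on which `g` acts as a
nontrivial translation. -/
def IsAxis (ρ : G →* (T ≃ᵢ T)) (g : G) (A : Set T) : Prop :=
  (∃ f : ℝ → T, Isometry f ∧ Set.range f = A) ∧
  (∀ x : T, x ∈ A ↔ ρ g x ∈ A) ∧
  ∃ τ : ℝ, 0 < τ ∧ ∀ x ∈ A, dist x (ρ g x) = τ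

/-- `g` is loxodromic: it has an axis. (For a loxodromic element `g`, the axis coincides
with `charSet ρ g`.) -/
def Loxodromic (ρ : G →* (T ≃ᵢ T)) (g : G) : Prop := ∃ A : Set T, IsAxis ρ g A

/-- A subtree is a convex subset. -/
def IsSubtree {T' : Type*} [MetricSpace T'] (A : Set T') : Prop :=
  ∀ x ∈ A, ∀ y ∈ A, seg x y ⊆ A

/-- The action is minimal: there is no proper nonempty invariant subtree. -/
def MinimalTreeAction (ρ : G →* (T ≃ᵢ T)) : Prop :=
  ∀ A : Set T, A.Nonempty → IsSubtree A → (∀ (g : G), ∀ x ∈ A, ρ g x ∈ A) → A = Set.univ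

/-- The action is nonelementary: there are two loxodromic elements whose axes intersect
in a compact (possibly empty) set. -/
def NonelementaryTreeAction (ρ : G →* (T ≃ᵢ T)) : Prop :=
  ∃ g h : G, Loxodromic ρ g ∧ Loxodromic ρ h ∧
    IsCompact (charSet ρ g ∩ charSet ρ h)

end TreeAction


lemma geod_between {T : Type*} [MetricSpace T] (hG : GeodesicSpace T) (p y z : T) (D : Set T)
    (hD : ∀ C : Set T, IsPreconnected C → p ∉ C → (C ∩ D).Nonempty → C ⊆ D)
    (hy : y ∈ D) (hz : z ∉ D) : dist z p + dist p y = dist z y := by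
  obtain ⟨f, f0, f1, hf⟩ := hG z y
  have hnn : (0:ℝ) ≤ dist z y := dist_nonneg
  have h0 : (0:ℝ) ∈ Icc (0:ℝ) (dist z y) := ⟨le_refl _, hnn⟩
  have h1 : dist z y ∈ Icc (0:ℝ) (dist z y) := ⟨hnn, le_refl _⟩
  have hpre : IsPreconnected (f '' Icc (0:ℝ) (dist z y)) := by
    apply isPreconnected_Icc.image
    have : LipschitzOnWith 1 f (Icc (0:ℝ) (dist z y)) := by
      apply LipschitzOnWith.of_dist_le_mul
      intro s hs t ht
      rw [hf s hs t ht, Real.dist_eq]; simp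
    exact this.continuousOn
  by_cases hp : p ∈ f '' Icc (0:ℝ) (dist z y)
  · obtain ⟨t, ht, rfl⟩ := hp
    have a := hf 0 h0 t ht
    have b := hf t ht _ h1
    rw [f0] at a
    rw [f1] at b
    rw [a, b, abs_of_nonpos (by linarith [ht.1]), abs_of_nonpos (by linarith [ht.2])]
    ring
  · exact absurd (hD _ hpre hp ⟨y, ⟨_, h1, f1⟩, hy⟩ ⟨0, h0, f0⟩) hz

lemma orbit_dist {T : Type*} [MetricSpace T] (hG : GeodesicSpace T) (h : T ≃ᵢ T) (x : T)
    (d : Set T) (hdir : ∃ y : T, y ≠ x ∧ d = connectedComponentIn ({x}ᶜ) y)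
    (hsub : (fun z : T => h z) '' d ⊂ d) :
    x ≠ h x ∧ ∀ n : ℕ, dist x ((h ^ n) x) = n * dist x (h x) := by
  obtain ⟨y, hyx, rfl⟩ := hdir
  set d := connectedComponentIn ({x}ᶜ) y with hd
  have hyd : y ∈ d := mem_connectedComponentIn hyx
  have hxd : x ∉ d := fun hx => connectedComponentIn_subset _ _ hx rfl
  have hdp : IsPreconnected d := isPreconnected_connectedComponentIn
  have hD : ∀ C : Set T, IsPreconnected C → x ∉ C → (C ∩ d).Nonempty → C ⊆ d := by
    rintro C hC hx ⟨w, hwC, hwd⟩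
    have h1 := hC.subset_connectedComponentIn hwC (subset_compl_singleton_iff.2 hx)
    rwa [← connectedComponentIn_eq hwd] at h1
  have hD' : ∀ C : Set T, IsPreconnected C → h x ∉ C →
      (C ∩ ((fun z : T => h z) '' d)).Nonempty → C ⊆ (fun z : T => h z) '' d := by
    rintro C hC hx ⟨w, hwC, v, hv, rfl⟩ c hc
    have := hD (h.symm '' C) (hC.image _ h.symm.continuous.continuousOn)
      (by rintro ⟨c, hc, rfl⟩; simp at hx; exact hx hc) ⟨v, ⟨_, hwC, by simp⟩, hv⟩
    exact ⟨h.symm c, this ⟨c, hc, rfl⟩, by simp⟩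
  have hin : ∀ z ∈ d, h z ∈ d := fun z hz => hsub.1 ⟨z, hz, rfl⟩
  have hgx : h x ∈ d := by
    by_contra hc
    exact hsub.2 (hD' d hdp hc ⟨h y, hin y hyd, y, hyd, rfl⟩)
  have horb : ∀ n : ℕ, (h ^ (n+1)) x ∈ d := by
    intro n
    induction n with
    | zero => simpa using hgx
    | succ n ih => rw [pow_succ']; exact hin _ ih
  refine ⟨fun e => hxd (e ▸ hgx), fun n => ?_⟩
  induction n with
  | zero => simp
  | succ n ih =>
    cases n with
    | zero => simp
    | succ n =>
      have := geod_between hG (h x) ((h ^ (n+1+1)) x) x _ hD'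
        ⟨(h ^ (n+1)) x, horb n, by rw [pow_succ' h (n+1)]; rfl⟩ (fun hc => hxd (hsub.1 hc))
      have e : dist (h x) ((h ^ (n+1+1)) x) = dist x ((h ^ (n+1)) x) := by
        rw [pow_succ' h (n+1)]; exact h.dist_eq _ _
      rw [← this, e, ih]; push_cast; ring

lemma axis_exists {T : Type*} [MetricSpace T] (hG : GeodesicSpace T) (h : T ≃ᵢ T) (x : T)
    (hL : 0 < dist x (h x)) (ho : ∀ n : ℕ, dist x ((h ^ n) x) = n * dist x (h x)) :
    ∃ f : ℝ → T, Isometry f ∧ ∀ t, h (f t) = f (t + dist x (h x)) := by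
  obtain ⟨γ, γ0, γ1, hγ⟩ := hG x (h x)
  set L := dist x (h x) with hLdef
  have hoz : ∀ i k : ℤ, i ≤ k → dist ((h ^ i) x) ((h ^ k) x) = (k - i) * L := by
    intro i k hik
    obtain ⟨n, rfl⟩ := Int.le.dest hik
    rw [zpow_add, zpow_natCast]
    have : dist ((h ^ i) x) ((h ^ i) ((h ^ n) x)) = dist x ((h ^ n) x) := (h ^ i).dist_eq _ _
    refine this.trans ((ho n).trans ?_)
    push_cast; ring
  have h0 : (0:ℝ) ∈ Icc (0:ℝ) L := ⟨le_refl _, hL.le⟩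
  have h1 : L ∈ Icc (0:ℝ) L := ⟨hL.le, le_refl _⟩
  let f : ℝ → T := fun t => (h ^ ⌊t / L⌋) (γ (t - ⌊t / L⌋ * L))
  have fl : ∀ t : ℝ, (⌊t / L⌋ : ℝ) * L ≤ t ∧ t < (⌊t / L⌋ + 1) * L := fun t =>
    ⟨(le_div_iff₀ hL).1 (Int.floor_le _), (div_lt_iff₀ hL).1 (Int.lt_floor_add_one _)⟩
  have fm : ∀ t : ℝ, t - ⌊t / L⌋ * L ∈ Icc (0:ℝ) L := fun t =>
    ⟨by linarith [(fl t).1], by linarith [(fl t).2]⟩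
  have fL : ∀ t : ℝ, dist ((h ^ ⌊t / L⌋) x) (f t) = t - ⌊t / L⌋ * L := by
    intro t
    have := hγ 0 h0 _ (fm t)
    rw [γ0] at this
    refine ((h ^ ⌊t / L⌋).dist_eq _ _).trans (this.trans ?_)
    rw [abs_of_nonpos (by linarith [(fm t).1])]; ring
  have fR : ∀ t : ℝ, dist (f t) ((h ^ (⌊t / L⌋ + 1)) x) = (⌊t / L⌋ + 1) * L - t := by
    intro t
    have := hγ _ (fm t) L h1
    rw [γ1] at this
    rw [zpow_add_one]
    refine ((h ^ ⌊t / L⌋).dist_eq _ _).trans (this.trans ?_)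
    rw [abs_of_nonpos (by linarith [(fm t).2])]; ring
  have key : ∀ s t : ℝ, s ≤ t → dist (f s) (f t) = t - s := by
    intro s t hst
    have hfl : ⌊s / L⌋ ≤ ⌊t / L⌋ := Int.floor_le_floor (by gcongr)
    rcases hfl.eq_or_lt with e | hlt
    · have := hγ _ (fm s) _ (fm t)
      have h2 : dist (f s) (f t) = dist (γ (s - ⌊s / L⌋ * L)) (γ (t - ⌊t / L⌋ * L)) := by
        simp only [f]
        rw [e]
        exact (h ^ ⌊t / L⌋).dist_eq _ _
      rw [h2, this, e, abs_of_nonpos (by linarith)]; ring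
    · have a1 := fR s
      have a2 := fL t
      have a3 := hoz (⌊s / L⌋ + 1) ⌊t / L⌋ hlt
      have b1 := fL s
      have b2 := fR t
      have b3 := hoz ⌊s / L⌋ (⌊t / L⌋ + 1) (by lia)
      have c1 := dist_triangle4 (f s) ((h ^ (⌊s / L⌋ + 1)) x) ((h ^ ⌊t / L⌋) x) (f t)
      have c2 := dist_triangle4 ((h ^ ⌊s / L⌋) x) (f s) (f t) ((h ^ (⌊t / L⌋ + 1)) x)
      push_cast at a3 b3
      apply le_antisymm <;> linarith
  refine ⟨f, Isometry.of_dist_eq fun s t => ?_, fun t => ?_⟩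
  · rcases le_total s t with hst | hst
    · rw [key s t hst, Real.dist_eq, abs_of_nonpos (by linarith)]; ring
    · rw [dist_comm, key t s hst, Real.dist_eq, abs_of_nonneg (by linarith)]
  · have e : (t + L) / L = t / L + 1 := by field_simp
    simp only [f]
    rw [e, Int.floor_add_one, add_comm ⌊t / L⌋ 1, zpow_one_add]
    have e2 : t + L - ((1 + ⌊t / L⌋ : ℤ) : ℝ) * L = t - ⌊t / L⌋ * L := by push_cast; ring
    rw [e2]; rfl

lemma disp_ge {T : Type*} [MetricSpace T] (h : T ≃ᵢ T) (x w : T)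
    (ho : ∀ n : ℕ, dist x ((h ^ n) x) = n * dist x (h x)) : dist x (h x) ≤ dist w (h w) := by
  have hw : ∀ n : ℕ, dist w ((h ^ n) w) ≤ n * dist w (h w) := by
    intro n
    induction n with
    | zero => simp
    | succ n ih =>
      have e : dist ((h ^ n) w) ((h ^ (n+1)) w) = dist w (h w) := by
        rw [pow_succ]; exact (h ^ n).dist_eq _ _
      have := dist_triangle w ((h ^ n) w) ((h ^ (n+1)) w)
      push_cast; linarith
  by_contra! hc
  obtain ⟨n, hn⟩ := exists_nat_gt (2 * dist x w / (dist x (h x) - dist w (h w)))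
  rw [div_lt_iff₀ (by linarith)] at hn
  have e : dist ((h ^ n) w) ((h ^ n) x) = dist w x := (h ^ n).dist_eq _ _
  have := dist_triangle4 x w ((h ^ n) w) ((h ^ n) x)
  rw [dist_comm w x] at e
  linarith [hw n, ho n]

/-- If `g` maps a direction at `x` strictly inside itself, then `g` is loxodromic and
the segment `[x, g x]` is contained in its axis. -/
theorem loxodromic_of_direction_strictly_contracted
    (G : Type*) [Group G] (T : Type*) [MetricSpace T] (hT : IsRealTree T)
    (ρ : G →* (T ≃ᵢ T)) (x : T) (d : Set T)
    (hdir : ∃ y : T, y ≠ x ∧ d = connectedComponentIn ({x}ᶜ) y)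
    (g : G) (hsub : (fun z : T => ρ g z) '' d ⊂ d) :
    Loxodromic ρ g ∧ seg x (ρ g x) ⊆ charSet ρ g := by
  obtain ⟨hne, ho⟩ := orbit_dist hT.1 (ρ g) x d hdir hsub
  have hL : 0 < dist x (ρ g x) := dist_pos.2 hne
  obtain ⟨f, hf, hft⟩ := axis_exists hT.1 (ρ g) x hL ho
  refine ⟨⟨range f, ⟨f, hf, rfl⟩, fun z => ⟨?_, ?_⟩, dist x (ρ g x), hL, ?_⟩, ?_⟩
  · rintro ⟨t, rfl⟩
    exact ⟨_, (hft t).symm⟩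
  · rintro ⟨t, ht⟩
    refine ⟨t - dist x (ρ g x), (ρ g).injective ?_⟩
    rw [hft, sub_add_cancel, ht]
  · rintro _ ⟨t, rfl⟩
    rw [hft, hf.dist_eq, Real.dist_eq, abs_of_nonpos (by linarith)]; ring
  · intro z hz
    have hz' : dist x z + dist z (ρ g x) = dist x (ρ g x) := hz
    have hge := fun w => disp_ge (ρ g) x w ho
    have e : dist (ρ g x) (ρ g z) = dist x z := (ρ g).dist_eq _ _
    have hle := dist_triangle z (ρ g x) (ρ g z)
    have hbdd : BddBelow (range fun w : T => dist w (ρ g w)) :=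
      ⟨0, by rintro _ ⟨w, rfl⟩; exact dist_nonneg⟩
    haveI : Nonempty T := ⟨x⟩
    show dist z (ρ g z) = ⨅ w : T, dist w (ρ g w)
    apply le_antisymm
    · exact le_ciInf fun w => by linarith [hge w]
    · exact ciInf_le hbdd z
end
end

section
/- Let G be a group acting by isometries on a simplicial tree T with the simplicial metric. Let L >= 1 and N >= 0, let g in G be an element which is (L,N)-WPD in T, and let h be any element of G. If Axis_T(g) ∩ Char_T(h) has length at least (N+2)·L·max{||g||_T, ||h||_T}, then h belongs to E(g). -/
noncomputable section

open Metric Set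

universe u v

/-- An element `g` is loxodromic for the action `ρ` on `Y` if its orbit maps are
quasi-isometric embeddings of `ℤ` into `Y`. -/
def IsLoxodromicIn {G : Type*} [Group G] {Y : Type*} [MetricSpace Y]
    (ρ : G →* (Y ≃ᵢ Y)) (g : G) : Prop :=
  ∃ y : Y, ∃ a b C : ℝ, 0 < a ∧ ∀ n m : ℤ,
    a * |(n : ℝ) - (m : ℝ)| - C ≤ dist (ρ (g ^ n) y) (ρ (g ^ m) y) ∧
    dist (ρ (g ^ n) y) (ρ (g ^ m) y) ≤ b * |(n : ℝ) - (m : ℝ)| + C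

/-- WPD property (Bestvina--Fujiwara) for an element `g` with respect to the action `ρ`. -/
def IsWPD {G : Type*} [Group G] {Y : Type*} [MetricSpace Y]
    (ρ : G →* (Y ≃ᵢ Y)) (g : G) : Prop :=
  IsLoxodromicIn ρ g ∧
  ∀ R : ℝ, 0 < R → ∀ y : Y, ∃ N : ℕ,
    Set.Finite {h : G | dist y (ρ h y) ≤ R ∧
      dist (ρ (g ^ N) y) (ρ h (ρ (g ^ N) y)) ≤ R}

/-- `E(g)`: the set of elements `h` with `h g^n h⁻¹ = g^m` for some nonzero integers `n, m`. -/
def Eset {G : Type*} [Group G] (g : G) : Set G :=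
  {h : G | ∃ n m : ℤ, n ≠ 0 ∧ m ≠ 0 ∧ h * g ^ n * h⁻¹ = g ^ m}

/-- An element of a group is generalised loxodromic if it is loxodromic for some
acylindrical action of the group on a hyperbolic space. -/
def IsGeneralizedLoxodromic {H : Type u} [Group H] (h : H) : Prop :=
  ∃ (Y : Type u) (_ : MetricSpace Y) (σ : H →* (Y ≃ᵢ Y)),
    HyperbolicGeodesicSpace Y ∧ IsAcylindrical σ ∧ IsLoxodromicIn σ h

section TreeMore

variable {G : Type*} [Group G] {T : Type*} [MetricSpace T]

/-- Pointwise stabilizer of a subset of `T`. -/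
def setStabilizer (ρ : G →* (T ≃ᵢ T)) (s : Set T) : Subgroup G where
  carrier := {g : G | ∀ z ∈ s, ρ g z = z}
  one_mem' := fun z _ => by simp
  mul_mem' := @fun a b ha hb z hz => by
    have h1 : (ρ (a * b)) z = ρ a (ρ b z) := by rw [map_mul]; rfl
    rw [h1, hb z hz, ha z hz]
  inv_mem' := @fun a ha z hz => by
    have h1 : ρ a z = z := ha z hz
    calc ρ a⁻¹ z = ρ a⁻¹ (ρ a z) := by rw [h1]
    _ = (ρ a⁻¹ * ρ a) z := rfl
    _ = z := by rw [← map_mul]; simp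

/-- Closest-point projection of the subset `A` onto the subset `B`. -/
def projSet {T' : Type*} [MetricSpace T'] (A B : Set T') : Set T' :=
  {y : T' | y ∈ B ∧ ∃ x ∈ A, dist x y = Metric.infDist x B}

/-- The bridge between two subsets `A, B`: the shortest segment from a point of `A`
to a point of `B`. -/
def IsBridge {T' : Type*} [MetricSpace T'] (A B I : Set T') : Prop :=
  ∃ a b : T', a ∈ A ∧ b ∈ B ∧ I = seg a b ∧
    ∀ a' ∈ A, ∀ b' ∈ B, dist a b ≤ dist a' b'

/-- `u` and `v` are the endpoints of an edge of the simplicial structure with vertex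
set `V`. -/
def IsSimpEdge {T' : Type*} [MetricSpace T'] (V : Set T') (u v : T') : Prop :=
  u ∈ V ∧ v ∈ V ∧ u ≠ v ∧ seg u v ∩ V = {u, v}

/-- `V` is the vertex set of a `G`-invariant simplicial structure on the tree `T`,
all of whose edges have length `1` (the simplicial metric). -/
def IsUnitSimplicial (ρ : G →* (T ≃ᵢ T)) (V : Set T) : Prop :=
  (∀ (g : G), ∀ v ∈ V, ρ g v ∈ V) ∧
  (∀ u ∈ V, ∀ v ∈ V, u ≠ v → 1 ≤ dist u v) ∧
  (∀ u v : T, IsSimpEdge V u v → dist u v = 1) ∧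
  (∀ x : T, ∃ u ∈ V, ∃ v ∈ V, x ∈ seg u v)

/-- `V` is the vertex set of a `G`-invariant simplicial structure on the tree `T`
(with arbitrary edge lengths). -/
def IsSimplicialStructure (ρ : G →* (T ≃ᵢ T)) (V : Set T) : Prop :=
  (∀ (g : G), ∀ v ∈ V, ρ g v ∈ V) ∧
  (∀ u ∈ V, ∀ v ∈ V, (seg u v ∩ V).Finite) ∧
  (∀ x : T, ∃ u ∈ V, ∃ v ∈ V, x ∈ seg u v)

/-- `g` is an `(L,N)`-WPD element for the action on the tree `T`: it is loxodromic and
the pointwise stabiliser of every arc of its axis of length at least `L` has at most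
`N` elements. -/
def IsLNWPD (ρ : G →* (T ≃ᵢ T)) (L : ℝ) (N : ℕ) (g : G) : Prop :=
  Loxodromic ρ g ∧
  ∀ x y : T, x ∈ charSet ρ g → y ∈ charSet ρ g → L ≤ dist x y →
    ∃ s : Finset G, s.card ≤ N ∧ ∀ k : G, (∀ z ∈ seg x y, ρ k z = z) → k ∈ s

/-- WPD element of a group action on a simplicial tree. -/
def IsTreeWPD (ρ : G →* (T ≃ᵢ T)) (g : G) : Prop :=
  ∃ L : ℝ, 0 ≤ L ∧ ∃ N : ℕ, IsLNWPD ρ L N g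

end TreeMore



section Helpers

variable {G : Type*} [Group G] {T : Type*} [MetricSpace T]

lemma aux_arc {γ : ℝ → T} {D : ℝ} (hD : 0 < D)
    (hlip : ∀ s ∈ Set.Icc (0:ℝ) D, ∀ t ∈ Set.Icc (0:ℝ) D, dist (γ s) (γ t) ≤ |s - t|)
    (hinj : ∀ s ∈ Set.Icc (0:ℝ) D, ∀ t ∈ Set.Icc (0:ℝ) D, γ s = γ t → s = t) :
    IsArcBetween (γ 0) (γ D) (γ '' Set.Icc 0 D) := by
  have hm : ∀ u ∈ Set.Icc (0:ℝ) 1, D * u ∈ Set.Icc (0:ℝ) D := by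
    intro u hu
    exact ⟨mul_nonneg hD.le hu.1, by nlinarith [hu.2]⟩
  refine ⟨fun u => γ (D * u), ?_, ?_, by simp, by simp, ?_⟩
  · have : LipschitzOnWith (Real.toNNReal D) (fun u => γ (D * u)) (Set.Icc 0 1) := by
      apply LipschitzOnWith.of_dist_le_mul
      intro a ha b hb
      refine (hlip _ (hm a ha) _ (hm b hb)).trans ?_
      rw [← mul_sub, abs_mul, abs_of_pos hD, Real.coe_toNNReal _ hD.le, Real.dist_eq]
    exact this.continuousOn
  · intro a ha b hb hab
    have := hinj _ (hm a ha) _ (hm b hb) hab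
    exact mul_left_cancel₀ hD.ne' this
  · ext z
    constructor
    · rintro ⟨s, hs, rfl⟩
      refine ⟨s / D, ⟨div_nonneg hs.1 hD.le, (div_le_one hD).2 hs.2⟩, ?_⟩
      simp only
      rw [mul_div_cancel₀ _ hD.ne']
    · rintro ⟨u, hu, rfl⟩
      exact ⟨D * u, hm u hu, rfl⟩

lemma aux_median (hT : IsRealTree T) {f : ℝ → T} {l : ℝ} (hl : 0 ≤ l)
    (hf : ∀ s ∈ Set.Icc (0:ℝ) l, ∀ t ∈ Set.Icc (0:ℝ) l, dist (f s) (f t) = |s - t|) (z : T) :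
    ∃ s ∈ Set.Icc (0:ℝ) l, dist (f 0) z = s + dist (f s) z ∧
      dist (f l) z = (l - s) + dist (f s) z := by
  obtain ⟨k, hk0, hk1, hk⟩ := hT.1 (f 0) z
  set m := dist (f 0) z with hm
  have hm0 : 0 ≤ m := dist_nonneg
  set S : Set ℝ := {s | 0 ≤ s ∧ s ≤ l ∧ s ≤ m ∧ f s = k s} with hS
  have h0S : (0:ℝ) ∈ S := ⟨le_rfl, hl, hm0, hk0.symm⟩
  have hbdd : BddAbove S := ⟨l, fun s hs => hs.2.1⟩
  set c := sSup S with hc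
  have hc0 : 0 ≤ c := le_csSup hbdd h0S
  have hcl : c ≤ l := csSup_le ⟨0, h0S⟩ fun s hs => hs.2.1
  have hcm : c ≤ m := csSup_le ⟨0, h0S⟩ fun s hs => hs.2.2.1
  have hfc : f c = k c := by
    apply eq_of_forall_dist_le
    intro ε hε
    obtain ⟨s, hs, hsc⟩ := exists_lt_of_lt_csSup ⟨0, h0S⟩ (show c - ε / 2 < sSup S by linarith)
    have hsc' : s ≤ c := le_csSup hbdd hs
    have h1 := hf c ⟨hc0, hcl⟩ s ⟨hs.1, hs.2.1⟩
    have h2 := hk s ⟨hs.1, hs.2.2.1⟩ c ⟨hc0, hcm⟩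
    have h3 := dist_triangle (f c) (f s) (k c)
    rw [hs.2.2.2] at h1 h3
    rw [abs_of_nonneg (by linarith)] at h1
    rw [abs_of_nonpos (by linarith)] at h2
    linarith
  have hsup : ∀ s, c < s → s ≤ l → s ≤ m → f s ≠ k s := by
    intro s hs h1 h2 h3
    exact absurd (le_csSup hbdd (show s ∈ S from ⟨by linarith, h1, h2, h3⟩)) (not_le.2 hs)
  have hcz : dist (f c) z = m - c := by
    have := hk c ⟨hc0, hcm⟩ m ⟨hm0, le_rfl⟩
    rw [hk1, ← hfc, abs_of_nonpos (by linarith)] at this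
    linarith
  have hly : dist (f l) (f c) = l - c := by
    rw [hf l ⟨hl, le_rfl⟩ c ⟨hc0, hcl⟩, abs_of_nonneg (by linarith)]
  refine ⟨c, ⟨hc0, hcl⟩, by linarith, ?_⟩
  rcases (show 0 ≤ (l - c) + (m - c) by linarith).eq_or_lt with hD | hD
  · have h1 : f c = z := by
      rw [← dist_eq_zero]; linarith
    have h2 : f l = f c := by
      rw [← dist_eq_zero]; linarith
    rw [h2, h1, dist_self]; linarith
  set γ : ℝ → T := fun t => if t ≤ l - c then f (l - t) else k (c + (t - (l - c))) with hγ
  set D := (l - c) + (m - c) with hDdef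
  have g1 : ∀ t, t ≤ l - c → γ t = f (l - t) := fun t ht => if_pos ht
  have g2 : ∀ t, l - c < t → γ t = k (c + (t - (l - c))) := fun t ht => if_neg (not_le.2 ht)
  have hmix : ∀ s ∈ Set.Icc (0:ℝ) D, ∀ t ∈ Set.Icc (0:ℝ) D, s ≤ l - c → l - c < t →
      dist (γ s) (γ t) ≤ |s - t| ∧ γ s ≠ γ t := by
    intro s hs t ht h1 h2
    have hs0 := hs.1
    have ht1 := ht.2
    rw [g1 s h1, g2 t h2]
    constructor
    · have a1 := hf (l - s) ⟨by linarith, by linarith⟩ c ⟨hc0, hcl⟩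
      have a2 := hk c ⟨hc0, hcm⟩ (c + (t - (l - c))) ⟨by linarith, by linarith⟩
      have a3 := dist_triangle (f (l - s)) (f c) (k (c + (t - (l - c))))
      rw [abs_of_nonneg (by linarith)] at a1
      rw [abs_of_nonpos (by linarith)] at a2
      rw [abs_of_nonpos (by linarith)]
      rw [← hfc] at a2
      linarith
    · intro he
      have a1 := hf 0 ⟨le_rfl, hl⟩ (l - s) ⟨by linarith, by linarith⟩
      have a2 := hk 0 ⟨le_rfl, hm0⟩ (c + (t - (l - c))) ⟨by linarith, by linarith⟩
      rw [hk0, ← he, a1, abs_of_nonpos (by linarith), abs_of_nonpos (by linarith)] at a2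
      have a3 : c + (t - (l - c)) = l - s := by linarith
      rw [a3] at he
      exact hsup (l - s) (by linarith) (by linarith) (by linarith) he
  have hA1 : IsArcBetween (γ 0) (γ D) (γ '' Set.Icc 0 D) := by
    have hsame1 : ∀ s ∈ Set.Icc (0:ℝ) D, ∀ t ∈ Set.Icc (0:ℝ) D, s ≤ l - c → t ≤ l - c →
        dist (γ s) (γ t) = |s - t| := by
      intro s hs t ht h1 h2
      rw [g1 s h1, g1 t h2, hf _ ⟨by linarith, by linarith [hs.1]⟩ _
        ⟨by linarith, by linarith [ht.1]⟩, abs_sub_comm]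
      congr 1; ring
    have hsame2 : ∀ s ∈ Set.Icc (0:ℝ) D, ∀ t ∈ Set.Icc (0:ℝ) D, l - c < s → l - c < t →
        dist (γ s) (γ t) = |s - t| := by
      intro s hs t ht h1 h2
      rw [g2 s h1, g2 t h2, hk _ ⟨by linarith, by linarith [hs.2]⟩ _
        ⟨by linarith, by linarith [ht.2]⟩]
      congr 1; ring
    apply aux_arc hD
    · intro s hs t ht
      rcases le_or_gt s (l - c) with h1 | h1 <;> rcases le_or_gt t (l - c) with h2 | h2
      · exact (hsame1 s hs t ht h1 h2).le
      · exact (hmix s hs t ht h1 h2).1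
      · rw [dist_comm, abs_sub_comm]; exact (hmix t ht s hs h2 h1).1
      · exact (hsame2 s hs t ht h1 h2).le
    · intro s hs t ht he
      rcases le_or_gt s (l - c) with h1 | h1 <;> rcases le_or_gt t (l - c) with h2 | h2
      · have := hsame1 s hs t ht h1 h2
        rw [he, dist_self] at this
        linarith [abs_eq_zero.1 this.symm]
      · exact absurd he (hmix s hs t ht h1 h2).2
      · exact absurd he.symm (hmix t ht s hs h2 h1).2
      · have := hsame2 s hs t ht h1 h2
        rw [he, dist_self] at this
        linarith [abs_eq_zero.1 this.symm]
  have hγ0 : γ 0 = f l := by rw [g1 0 (by linarith), sub_zero]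
  have hγD : γ D = z := by
    rcases le_or_gt D (l - c) with h1 | h1
    · have : m = c := by linarith
      rw [g1 D h1, show l - D = c by linarith, ← dist_eq_zero]; linarith
    · rw [g2 D h1, show c + (D - (l - c)) = m by rw [hDdef]; ring, hk1]
  have hyz : 0 < dist (f l) z := by
    rw [dist_pos]
    intro he
    rcases le_or_gt D (l - c) with h1 | h1
    · have h2 := hf l ⟨hl, le_rfl⟩ (l - D) ⟨by linarith, by linarith⟩
      rw [← g1 D h1, hγD, he, dist_self] at h2
      have := abs_eq_zero.1 h2.symm
      linarith
    · exact (hmix 0 ⟨le_rfl, hD.le⟩ D ⟨hD.le, le_rfl⟩ (by linarith) h1).2 (by rw [hγ0, hγD, he])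
  obtain ⟨q, hq0, hq1, hq⟩ := hT.1 (f l) z
  have hA2 := aux_arc (γ := q) hyz (fun s hs t ht => (hq s hs t ht).le) (by
    intro s hs t ht he
    have := hq s hs t ht
    rw [he, dist_self] at this
    linarith [abs_eq_zero.1 this.symm])
  rw [hγ0, hγD] at hA1
  rw [hq0, hq1] at hA2
  have hE := hT.2 _ _ _ _ hA1 hA2
  have hcmem : f c ∈ γ '' Set.Icc 0 D :=
    ⟨l - c, ⟨by linarith, by linarith⟩, by rw [g1 _ le_rfl]; congr 1; ring⟩
  rw [hE] at hcmem
  obtain ⟨r, hr, hrc⟩ := hcmem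
  have b1 := hq 0 ⟨le_rfl, hyz.le⟩ r hr
  have b2 := hq r hr _ ⟨hyz.le, le_rfl⟩
  rw [hq0, hrc, abs_of_nonpos (by linarith [hr.1])] at b1
  rw [hq1, hrc, abs_of_nonpos (by linarith [hr.2])] at b2
  linarith

lemma aux_four (hT : IsRealTree T) (x y z w : T) :
    dist x y + dist z w ≤ max (dist x z + dist y w) (dist x w + dist y z) := by
  obtain ⟨f, h0, h1, hf⟩ := hT.1 x y
  obtain ⟨s, hs, a1, a2⟩ := aux_median hT dist_nonneg hf z
  obtain ⟨t, ht, b1, b2⟩ := aux_median hT dist_nonneg hf w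
  rw [h0] at a1 b1
  rw [h1] at a2 b2
  have h2 := hf s hs t ht
  have h3 := dist_triangle4 z (f s) (f t) w
  rw [dist_comm z (f s)] at h3
  rcases le_total s t with h | h
  · rw [abs_of_nonpos (by linarith)] at h2
    exact le_max_of_le_right (by linarith)
  · rw [abs_of_nonneg (by linarith)] at h2
    exact le_max_of_le_left (by linarith)

lemma aux_unique (hT : IsRealTree T) {x y p q : T} {s : ℝ} (hp : dist x p = s)
    (hp' : dist p y = dist x y - s) (hq : dist x q = s) (hq' : dist q y = dist x y - s) :
    p = q := by
  have h := aux_four hT x y p q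
  rw [dist_comm y q, dist_comm y p, hp, hp', hq, hq', max_self] at h
  rw [← dist_eq_zero]
  linarith [dist_nonneg (x := p) (y := q)]

/-- Isometries displacing both ends of a long segment minimally translate along it. -/
lemma aux_translate (hT : IsRealTree T) (ρ : G →* (T ≃ᵢ T)) (h : G) {f : ℝ → T} {l : ℝ}
    (hl : 0 ≤ l)
    (hf : ∀ s ∈ Set.Icc (0:ℝ) l, ∀ t ∈ Set.Icc (0:ℝ) l, dist (f s) (f t) = |s - t|)
    (hx : f 0 ∈ charSet ρ h) (hy : f l ∈ charSet ρ h) (hlt : transLen ρ h < l) :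
    ∃ h' : G, (h' = h ∨ h' = h⁻¹) ∧
      ∀ t, 0 ≤ t → t + transLen ρ h ≤ l → ρ h' (f t) = f (t + transLen ρ h) := by
  set τ := transLen ρ h with hτ
  have hx' : dist (f 0) (ρ h (f 0)) = τ := hx
  have hy' : dist (f l) (ρ h (f l)) = τ := hy
  have hτ0 : 0 ≤ τ := hx' ▸ dist_nonneg
  have hiso : ∀ a b, dist (ρ h a) (ρ h b) = dist a b := fun a b => (ρ h).isometry.dist_eq a b
  have hxy : dist (f 0) (f l) = l := by
    rw [hf 0 ⟨le_rfl, hl⟩ l ⟨hl, le_rfl⟩, abs_of_nonpos (by linarith)]; ring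
  have hmin : ∀ p, τ ≤ dist p (ρ h p) := fun p =>
    ciInf_le ⟨0, by rintro _ ⟨a, rfl⟩; exact dist_nonneg⟩ p
  have hf0 : ∀ s, 0 ≤ s → s ≤ l → dist (f 0) (f s) = s := by
    intro s h1 h2
    rw [hf 0 ⟨le_rfl, hl⟩ s ⟨h1, h2⟩, abs_of_nonpos (by linarith)]; ring
  have hfl : ∀ s, 0 ≤ s → s ≤ l → dist (f s) (f l) = l - s := by
    intro s h1 h2
    rw [hf s ⟨h1, h2⟩ l ⟨hl, le_rfl⟩, abs_of_nonpos (by linarith)]; ring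
  set x := f 0 with hxdef
  set y := f l with hydef
  have hxy' : dist (ρ h x) (ρ h y) = l := by rw [hiso, hxy]
  -- the sum of diagonals
  have hS1 := aux_four hT x y (ρ h x) (ρ h y)
  have hS2 := aux_four hT x (ρ h y) y (ρ h x)
  rw [hx', hy', hxy, hxy'] at hS1
  rw [hx', dist_comm (ρ h y) (ρ h x), hxy', dist_comm (ρ h y) y, hy', hxy] at hS2
  have hsum : dist x (ρ h y) + dist y (ρ h x) = l + l := by
    apply le_antisymm
    · rcases le_max_iff.1 hS2 with h1 | h1 <;> linarith
    · rcases le_max_iff.1 hS1 with h1 | h1 <;> linarith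
  obtain ⟨c, hc⟩ : ∃ c, c = dist x (ρ h y) - l := ⟨_, rfl⟩
  have hc1 : dist x (ρ h y) = l + c := by linarith
  have hc2 : dist y (ρ h x) = l - c := by linarith
  have hcu : c ≤ τ := by linarith [dist_triangle x y (ρ h y)]
  have hcd : -τ ≤ c := by linarith [dist_triangle y x (ρ h x), dist_comm x y]
  have hcabs : τ ≤ |c| := by
    set p := f (l / 2) with hp
    have e1 : dist x p = l / 2 := hf0 _ (by linarith) (by linarith)
    have e2 : dist p y = l / 2 := by rw [hfl _ (by linarith) (by linarith)]; ring
    have q1 := aux_four hT p (ρ h x) x y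
    have q2 := aux_four hT p (ρ h y) x y
    have q3 := aux_four hT p (ρ h p) (ρ h x) (ρ h y)
    rw [hxy, dist_comm (ρ h x) y, hc2, dist_comm p x, e1, e2, dist_comm (ρ h x) x, hx'] at q1
    rw [hxy, dist_comm (ρ h y) y, hy', dist_comm p x, e1, e2, dist_comm (ρ h y) x, hc1] at q2
    rw [hxy', hiso p y, hiso p x, e2, dist_comm p x, e1] at q3
    have q4 := hmin p
    have := le_abs_self c
    have := neg_abs_le c
    by_contra hcon
    push Not at hcon
    rcases le_max_iff.1 q3 with h3 | h3
    · rcases le_max_iff.1 q1 with h1 | h1 <;> linarith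
    · rcases le_max_iff.1 q2 with h1 | h1 <;> linarith
  rcases le_total 0 c with hc0 | hc0
  · have hcτ : c = τ := by rw [abs_of_nonneg hc0] at hcabs; linarith
    refine ⟨h, Or.inl rfl, fun t ht0 ht1 => ?_⟩
    have e1 : dist (ρ h x) (ρ h (f t)) = t := by rw [hiso, hf0 t ht0 (by linarith)]
    have e2 : dist (ρ h (f t)) (ρ h y) = l - t := by rw [hiso, hfl t ht0 (by linarith)]
    have e3 : dist x (f (t + τ)) = t + τ := hf0 _ (by linarith) ht1
    have e4 : dist (f (t + τ)) y = l - (t + τ) := hfl _ (by linarith) ht1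
    refine aux_unique hT (x := x) (y := ρ h y) (s := t + τ) ?_ ?_ e3 ?_
    · linarith [dist_triangle x (ρ h x) (ρ h (f t)), dist_triangle x (ρ h (f t)) (ρ h y)]
    · linarith
    · linarith [dist_triangle x (f (t + τ)) (ρ h y), dist_triangle (f (t + τ)) y (ρ h y)]
  · have hcτ : c = -τ := by rw [abs_of_nonpos hc0] at hcabs; linarith
    refine ⟨h⁻¹, Or.inr rfl, fun t ht0 ht1 => ?_⟩
    have key : ρ h (f (t + τ)) = f t := by
      have e1 : dist (ρ h x) (ρ h (f (t + τ))) = t + τ := by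
        rw [hiso, hf0 _ (by linarith) ht1]
      have e2 : dist (ρ h (f (t + τ))) (ρ h y) = l - (t + τ) := by
        rw [hiso, hfl _ (by linarith) ht1]
      have e3 : dist x (f t) = t := hf0 _ ht0 (by linarith)
      have e4 : dist (f t) y = l - t := hfl _ ht0 (by linarith)
      have e5 : dist (ρ h x) y = l + τ := by rw [dist_comm, hc2]; linarith
      have e6 : dist (ρ h x) x = τ := by rw [dist_comm, hx']
      have e7 : dist (ρ h y) y = τ := by rw [dist_comm, hy']
      refine aux_unique hT (x := ρ h x) (y := y) (s := t + τ) e1 ?_ ?_ ?_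
      · linarith [dist_triangle (ρ h x) (ρ h (f (t + τ))) y,
          dist_triangle (ρ h (f (t + τ))) (ρ h y) y]
      · linarith [dist_triangle (ρ h x) x (f t), dist_triangle (ρ h x) (f t) y]
      · linarith
    rw [← key, map_inv]
    exact (ρ h).symm_apply_apply _

lemma aux_int {V : Set T} (h1 : ∀ u ∈ V, ∀ v ∈ V, u ≠ v → 1 ≤ dist u v)
    (h2 : ∀ u v : T, IsSimpEdge V u v → dist u v = 1) (n : ℕ) :
    ∀ u ∈ V, ∀ v ∈ V, dist u v ≤ n → ∃ k : ℕ, dist u v = k := by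
  induction n with
  | zero =>
    intro u _ v _ h
    exact ⟨0, le_antisymm (by simpa using h) (by simp)⟩
  | succ n ih =>
    intro u hu v hv h
    push_cast at h
    by_cases huv : u = v
    · exact ⟨0, by simp [huv]⟩
    by_cases he : seg u v ∩ V ⊆ {u, v}
    · refine ⟨1, ?_⟩
      rw [h2 u v ⟨hu, hv, huv, ?_⟩]; · simp
      apply Set.Subset.antisymm he
      rintro z (rfl | hz)
      · exact ⟨by simp [seg], hu⟩
      · rw [Set.mem_singleton_iff] at hz
        subst hz
        exact ⟨by simp [seg], hv⟩
    · obtain ⟨w, ⟨hw, hwV⟩, hne⟩ := Set.not_subset.1 he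
      simp only [Set.mem_insert_iff, Set.mem_singleton_iff, not_or] at hne
      have hw' : dist u w + dist w v = dist u v := hw
      have a1 := h1 u hu w hwV (Ne.symm hne.1)
      have a2 := h1 w hwV v hv hne.2
      obtain ⟨k1, hk1⟩ := ih u hu w hwV (by linarith)
      obtain ⟨k2, hk2⟩ := ih w hwV v hv (by linarith)
      exact ⟨k1 + k2, by push_cast; linarith⟩

lemma aux_shift (ρ : G →* (T ≃ᵢ T)) (g : G) (p : T) (n k : ℕ) :
    dist (ρ (g ^ k) p) (ρ (g ^ (k + n)) p) = dist p (ρ (g ^ n) p) := by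
  rw [pow_add, map_mul]
  exact (ρ (g ^ k)).isometry.dist_eq _ _

/-- four point condition along an orbit -/
lemma aux_orbit (hT : IsRealTree T) (ρ : G →* (T ≃ᵢ T)) (g : G) (p : T) (n : ℕ)
    (hn : dist p (ρ g p) < dist p (ρ (g ^ (n + 1)) p)) :
    dist p (ρ (g ^ (n + 2)) p) + dist p (ρ (g ^ n) p) = 2 * dist p (ρ (g ^ (n + 1)) p) := by
  have s1 := aux_shift ρ g p (n + 1) 1
  have s2 := aux_shift ρ g p n 1
  have s3 := aux_shift ρ g p 1 (n + 1)
  rw [show 1 + (n + 1) = n + 2 by ring, pow_one] at s1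
  rw [show 1 + n = n + 1 by ring, pow_one] at s2
  rw [show n + 1 + 1 = n + 2 by ring, pow_one] at s3
  have f1 := aux_four hT p (ρ (g ^ (n + 1)) p) (ρ g p) (ρ (g ^ (n + 2)) p)
  have f2 := aux_four hT p (ρ (g ^ (n + 2)) p) (ρ g p) (ρ (g ^ (n + 1)) p)
  rw [dist_comm (ρ (g ^ (n + 1)) p) (ρ g p)] at f1
  rw [dist_comm (ρ (g ^ (n + 2)) p) (ρ (g ^ (n + 1)) p),
    dist_comm (ρ (g ^ (n + 2)) p) (ρ g p)] at f2
  rw [s1, s2, s3] at f1 f2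
  apply le_antisymm
  · rcases le_max_iff.1 f2 with h | h <;> linarith
  · rcases le_max_iff.1 f1 with h | h <;> linarith

lemma aux_axis (hT : IsRealTree T) (ρ : G →* (T ≃ᵢ T)) (g : G) (hg : Loxodromic ρ g) :
    ∃ p : T, ∃ τ : ℝ, 0 < τ ∧ ∀ n : ℕ, dist p (ρ (g ^ n) p) = n * τ := by
  obtain ⟨A, ⟨f, hf, hA⟩, hinv, τ, hτ, hd⟩ := hg
  have hiso : ∀ a b, dist (ρ g a) (ρ g b) = dist a b := fun a b => (ρ g).isometry.dist_eq a b
  have hmem : ∀ t, f t ∈ A := fun t => hA ▸ Set.mem_range_self t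
  have hex : ∀ t, ∃ s, ρ g (f t) = f s := by
    intro t
    have : ρ g (f t) ∈ A := (hinv _).1 (hmem t)
    rw [← hA] at this
    obtain ⟨s, hs⟩ := this
    exact ⟨s, hs.symm⟩
  choose φ hφ using hex
  have h1 : ∀ t, |t - φ t| = τ := by
    intro t
    have := hd _ (hmem t)
    rwa [hφ, hf.dist_eq, Real.dist_eq] at this
  have h2 : ∀ s t, |φ s - φ t| = |s - t| := by
    intro s t
    have := hiso (f s) (f t)
    rwa [hφ, hφ, hf.dist_eq, hf.dist_eq, Real.dist_eq, Real.dist_eq] at this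
  have h3 : |0 - φ (φ 0)| = 2 * τ := by
    have a0 := h1 0
    have a1 := h1 (φ 0)
    have a2 := h1 (φ 0 / 2)
    have a3 := h2 0 (φ 0 / 2)
    have a4 := h2 (φ 0) (φ 0 / 2)
    generalize φ (φ 0) = u at *
    generalize φ (φ 0 / 2) = w at *
    generalize φ 0 = v at *
    rcases abs_eq_abs.1 (a1.trans a0.symm) with h | h
    · rw [show u = 2 * v by linarith, show 0 - 2 * v = 2 * (0 - v) by ring, abs_mul, a0]
      norm_num
    · have hu : u = 0 := by linarith
      subst hu
      exfalso
      have hw : w = v / 2 := by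
        rcases abs_eq_abs.1 a3 with k | k <;> rcases abs_eq_abs.1 a4 with k' | k' <;> linarith
      rw [hw, sub_self, abs_zero] at a2
      linarith
  have b1 : dist (f 0) (ρ g (f 0)) = τ := hd _ (hmem 0)
  have b2 : dist (f 0) (ρ (g ^ 2) (f 0)) = 2 * τ := by
    rw [pow_two, map_mul]
    change dist (f 0) (ρ g (ρ g (f 0))) = _
    rw [hφ, hφ, hf.dist_eq, Real.dist_eq, h3]
  refine ⟨f 0, τ, hτ, ?_⟩
  have : ∀ n : ℕ, dist (f 0) (ρ (g ^ (n + 1)) (f 0)) = (n + 1) * τ ∧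
      dist (f 0) (ρ (g ^ (n + 2)) (f 0)) = (n + 2) * τ := by
    intro n
    induction n with
    | zero => exact ⟨by simpa using b1, by simpa using b2⟩
    | succ n ih =>
      have hn : (0:ℝ) ≤ n := Nat.cast_nonneg n
      have h := aux_orbit hT ρ g (f 0) (n + 1) (by
        rw [show n + 1 + 1 = n + 2 by ring, ih.2, b1]; nlinarith)
      rw [show n + 1 + 1 = n + 2 by ring] at *
      rw [ih.1, ih.2] at h
      push_cast
      exact ⟨by rw [ih.2]; ring, by linarith⟩
  intro n
  cases n with
  | zero => simp
  | succ n => push_cast; exact (this n).1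

lemma aux_disp (ρ : G →* (T ≃ᵢ T)) (g : G) (p v : T) (n : ℕ) :
    dist v (ρ (g ^ n) v) ≤ 2 * dist v p + dist p (ρ (g ^ n) p) := by
  have h1 := dist_triangle4 v p (ρ (g ^ n) p) (ρ (g ^ n) v)
  rw [(ρ (g ^ n)).isometry.dist_eq, dist_comm p v] at h1
  linarith

lemma aux_disp_le (ρ : G →* (T ≃ᵢ T)) (g : G) (p : T) (n : ℕ) :
    dist p (ρ (g ^ n) p) ≤ n * dist p (ρ g p) := by
  induction n with
  | zero => simp
  | succ n ih =>
    have h := aux_shift ρ g p 1 n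
    rw [pow_one] at h
    have := dist_triangle p (ρ (g ^ n) p) (ρ (g ^ (n + 1)) p)
    push_cast
    linarith

lemma aux_one_le (hT : IsRealTree T) (ρ : G →* (T ≃ᵢ T)) (V : Set T)
    (hV : IsUnitSimplicial ρ V) (g : G) (hg : Loxodromic ρ g) : 1 ≤ transLen ρ g := by
  obtain ⟨p, τ, hτ, hp⟩ := aux_axis hT ρ g hg
  obtain ⟨v, hv, -⟩ := hV.2.2.2 p
  have hint : ∀ n : ℕ, ∃ k : ℕ, dist v (ρ (g ^ n) v) = k := by
    intro n
    obtain ⟨m, hm⟩ := exists_nat_ge (dist v (ρ (g ^ n) v))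
    exact aux_int hV.2.1 hV.2.2.1 m v hv _ (hV.1 _ v hv) hm
  choose a ha using hint
  have hlow : ∀ n : ℕ, n * τ - 2 * dist p v ≤ a n := by
    intro n
    have := aux_disp ρ g v p n
    rw [hp, ha] at this
    linarith
  -- beyond n0, a is larger than a 1
  obtain ⟨n0, hn0⟩ := exists_nat_ge (((a 1 : ℝ) + 1 + 2 * dist p v) / τ)
  rw [div_le_iff₀ hτ] at hn0
  have hrec : ∀ n, n0 ≤ n → a (n + 2) + a n = 2 * a (n + 1) := by
    intro n hn
    have hn' : (n0 : ℝ) ≤ n := by exact_mod_cast hn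
    have h := aux_orbit hT ρ g v n (by
      have h1 := hlow (n + 1)
      have h2 := ha 1
      rw [pow_one] at h2
      rw [h2, ha]
      push_cast at h1
      nlinarith)
    rw [ha, ha, ha] at h
    exact_mod_cast h
  have hstep : ∀ m, (a (n0 + m) : ℤ) = a n0 + m * (a (n0 + 1) - a n0) ∧
      (a (n0 + m + 1) : ℤ) = a n0 + (m + 1) * (a (n0 + 1) - a n0) := by
    intro m
    induction m with
    | zero => simp
    | succ m ih =>
      have h := hrec (n0 + m) (by omega)
      have h' : (a (n0 + m + 2) : ℤ) + a (n0 + m) = 2 * a (n0 + m + 1) := by exact_mod_cast h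
      rw [show n0 + (m + 1) = n0 + m + 1 by ring, show n0 + m + 1 + 1 = n0 + m + 2 by ring]
      push_cast
      exact ⟨ih.2, by linarith [ih.1, ih.2]⟩
  have hpos : 1 ≤ (a (n0 + 1) : ℤ) - a n0 := by
    by_contra hcon
    push Not at hcon
    obtain ⟨m, hm⟩ := exists_nat_ge (((a n0 : ℝ) + 1 + 2 * dist p v) / τ)
    rw [div_le_iff₀ hτ] at hm
    have h1 := hlow (n0 + m)
    have h2 : (a (n0 + m) : ℤ) ≤ a n0 := by
      rw [(hstep m).1]
      have : (0:ℤ) ≤ m := Int.natCast_nonneg m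
      nlinarith
    have h3 : (a (n0 + m) : ℝ) ≤ a n0 := by exact_mod_cast h2
    push_cast at h1
    have : (0:ℝ) ≤ n0 * τ := by positivity
    nlinarith
  haveI : Nonempty T := ⟨p⟩
  apply le_ciInf
  intro q
  by_contra hcon
  push Not at hcon
  set d := dist q (ρ g q) with hd
  obtain ⟨m, hm⟩ := exists_nat_ge ((2 * dist v q + n0 * d + 1) / (1 - d))
  rw [div_le_iff₀ (by linarith)] at hm
  have h1 : ((a n0 : ℤ) : ℝ) + m ≤ a (n0 + m) := by
    have : (a n0 : ℤ) + m ≤ a (n0 + m) := by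
      rw [(hstep m).1]
      have : (0:ℤ) ≤ m := Int.natCast_nonneg m
      nlinarith
    exact_mod_cast this
  have h2 := aux_disp ρ g q v (n0 + m)
  have h3 := aux_disp_le ρ g q (n0 + m)
  rw [ha] at h2
  push_cast at h1 h3
  have : (0:ℝ) ≤ a n0 := Nat.cast_nonneg _
  linarith

lemma aux_core (ρ : G →* (T ≃ᵢ T)) (g h : G) {f : ℝ → T} {l a b L : ℝ} {N : ℕ}
    (ha : 0 ≤ a) (hb : 0 ≤ b)
    (hga : ∀ t, 0 ≤ t → t + a ≤ l → ρ g (f t) = f (t + a))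
    (hhb : ∀ t, 0 ≤ t → t + b ≤ l → ρ h (f t) = f (t + b))
    (hlen : L + N * a + b ≤ l) (P : Set T)
    (hP : ∀ z ∈ P, ∃ t, 0 ≤ t ∧ t ≤ L ∧ z = f t)
    (s : Finset G) (hs : s.card ≤ N) (hsP : ∀ k : G, (∀ z ∈ P, ρ k z = z) → k ∈ s) :
    ∃ n : ℤ, n ≠ 0 ∧ Commute h (g ^ n) := by
  have hpow : ∀ i : ℕ, ∀ t, 0 ≤ t → t + i * a ≤ l → ρ (g ^ i) (f t) = f (t + i * a) := by
    intro i
    induction i with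
    | zero => intro t _ _; simp
    | succ i ih =>
      intro t h0 h1
      push_cast at h1
      have hi : (0:ℝ) ≤ i * a := by positivity
      rw [pow_succ', map_mul]
      change ρ g (ρ (g ^ i) (f t)) = _
      rw [ih t h0 (by linarith), hga _ (by linarith) (by linarith)]
      congr 1; push_cast; ring
  let c : ℕ → G := fun i => (g ^ i * h)⁻¹ * (h * g ^ i)
  have hc : ∀ i ∈ Finset.range (N + 1), c i ∈ s := by
    intro i hi
    apply hsP
    intro z hz
    obtain ⟨t, h0, h1, rfl⟩ := hP z hz
    have hi' : (i : ℝ) ≤ N := by exact_mod_cast Nat.lt_succ_iff.1 (Finset.mem_range.1 hi)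
    have hia : (i : ℝ) * a ≤ N * a := mul_le_mul_of_nonneg_right hi' ha
    have hi0 : (0:ℝ) ≤ i * a := by positivity
    have e1 : ρ (h * g ^ i) (f t) = f (t + i * a + b) := by
      rw [map_mul]
      change ρ h (ρ (g ^ i) (f t)) = _
      rw [hpow i t h0 (by linarith), hhb _ (by linarith) (by linarith)]
    have e2 : ρ (g ^ i * h) (f t) = f (t + i * a + b) := by
      rw [map_mul]
      change ρ (g ^ i) (ρ h (f t)) = _
      rw [hhb t h0 (by linarith), hpow i _ (by linarith) (by linarith)]
      congr 1; ring
    change ρ ((g ^ i * h)⁻¹ * (h * g ^ i)) (f t) = f t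
    rw [map_mul]
    change ρ (g ^ i * h)⁻¹ (ρ (h * g ^ i) (f t)) = _
    rw [e1, ← e2, map_inv]
    exact (ρ (g ^ i * h)).symm_apply_apply _
  obtain ⟨i, -, j, -, hij, he⟩ := Finset.exists_ne_map_eq_of_card_lt_of_maps_to
    (s := Finset.range (N + 1)) (t := s) (by rw [Finset.card_range]; omega) (f := c) hc
  refine ⟨(i : ℤ) - j, by omega, ?_⟩
  have he' : (g ^ i * h)⁻¹ * (h * g ^ i) = (g ^ j * h)⁻¹ * (h * g ^ j) := he
  simp only [mul_inv_rev] at he'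
  have h1 : (g ^ i)⁻¹ * h * g ^ i = (g ^ j)⁻¹ * h * g ^ j := by
    have := congrArg (fun z => h * z) he'
    simpa [mul_assoc] using this
  have h2 : g ^ ((i : ℤ) - j) = g ^ i * (g ^ j)⁻¹ := by
    rw [zpow_sub, zpow_natCast, zpow_natCast]
  have h3 : h * g ^ i = g ^ i * (g ^ j)⁻¹ * h * g ^ j := by
    have := congrArg (fun z => g ^ i * z) h1
    simpa [mul_assoc] using this
  rw [h2]
  change h * (g ^ i * (g ^ j)⁻¹) = g ^ i * (g ^ j)⁻¹ * h
  rw [← mul_assoc, h3, mul_inv_cancel_right]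

end Helpers

/-- If `g` is an `(L,N)`-WPD element of a `G`-action on a simplicial tree with the
simplicial metric, and the overlap of the axis of `g` with the characteristic set of
`h` has length at least `(N+2) L max(‖g‖, ‖h‖)`, then `h ∈ E(g)`. -/
theorem mem_Eset_of_long_overlap (G : Type*) [Group G] (T : Type*) [MetricSpace T]
    (hT : IsRealTree T) (ρ : G →* (T ≃ᵢ T)) (V : Set T) (hV : IsUnitSimplicial ρ V)
    (L : ℝ) (hL : 1 ≤ L) (N : ℕ) (g : G) (hg : IsLNWPD ρ L N g) (h : G)
    (hover : ∃ x ∈ charSet ρ g ∩ charSet ρ h, ∃ y ∈ charSet ρ g ∩ charSet ρ h,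
      ((N : ℝ) + 2) * L * max (transLen ρ g) (transLen ρ h) ≤ dist x y) :
    h ∈ Eset g := by
  obtain ⟨x, hx, y, hy, hle⟩ := hover
  have hg1 := aux_one_le hT ρ V hV g hg.1
  obtain ⟨f, h0, h1, hf⟩ := hT.1 x y
  set l := dist x y with hl
  set a := transLen ρ g with ha
  set b := transLen ρ h with hb
  set M := max a b with hM
  have haM : a ≤ M := le_max_left _ _
  have hbM : b ≤ M := le_max_right _ _
  have hb0 : 0 ≤ b := by
    have : dist x (ρ h x) = b := hx.2
    rw [← this]; exact dist_nonneg
  have hN : (0:ℝ) ≤ N := Nat.cast_nonneg N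
  have hLM : M ≤ L * M := by nlinarith
  have hLM' : L ≤ L * M := by nlinarith
  have hNLM : (N:ℝ) * M ≤ N * (L * M) := mul_le_mul_of_nonneg_left hLM hN
  have hNa : (N:ℝ) * a ≤ N * M := mul_le_mul_of_nonneg_left haM hN
  have hN0 : 0 ≤ (N:ℝ) * a := by positivity
  have hle' : N * (L * M) + 2 * (L * M) ≤ l := by linarith
  have hlen : L + N * a + b ≤ l := by linarith
  have hl0 : 0 ≤ l := dist_nonneg
  obtain ⟨g', hg', hga⟩ := aux_translate hT ρ g hl0 hf (by rw [h0]; exact hx.1)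
    (by rw [h1]; exact hy.1) (by linarith)
  obtain ⟨h', hh', hhb⟩ := aux_translate hT ρ h hl0 hf (by rw [h0]; exact hx.2)
    (by rw [h1]; exact hy.2) (by linarith)
  have hfL : dist (f 0) (f L) = L := by
    rw [hf 0 ⟨le_rfl, hl0⟩ L ⟨by linarith, by linarith⟩, abs_of_nonpos (by linarith)]; ring
  have hLmem : f L ∈ charSet ρ g := by
    change dist (f L) (ρ g (f L)) = a
    have e : dist (f L) (ρ g' (f L)) = a := by
      rw [hga L (by linarith) (by linarith),
        hf L ⟨by linarith, by linarith⟩ _ ⟨by linarith, by linarith⟩, abs_of_nonpos (by linarith)]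
      ring
    rcases hg' with rfl | rfl
    · exact e
    · rw [← e, ← (ρ g).isometry.dist_eq (f L) (ρ g⁻¹ (f L)), map_inv]
      have : ρ g ((ρ g)⁻¹ (f L)) = f L := (ρ g).apply_symm_apply _
      rw [this, dist_comm]
  obtain ⟨s, hs, hsP⟩ := hg.2 (f 0) (f L) (by rw [h0]; exact hx.1) hLmem hfL.ge
  obtain ⟨n, hn, hcomm⟩ := aux_core ρ g' h' (by linarith) hb0 hga hhb hlen (seg (f 0) (f L)) (by
    intro z hz
    have hz' : dist (f 0) z + dist z (f L) = dist (f 0) (f L) := hz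
    have hz1 : dist (f 0) z ≤ L := by linarith [dist_nonneg (x := z) (y := f L)]
    refine ⟨dist (f 0) z, dist_nonneg, hz1, ?_⟩
    refine aux_unique hT (x := f 0) (y := f L) (s := dist (f 0) z) rfl (by linarith) ?_ ?_
    · rw [hf 0 ⟨le_rfl, hl0⟩ _ ⟨dist_nonneg, by linarith⟩,
        abs_of_nonpos (by linarith [dist_nonneg (x := f 0) (y := z)])]; ring
    · rw [hf _ ⟨dist_nonneg, by linarith⟩ L ⟨by linarith, by linarith⟩, hfL,
        abs_of_nonpos (by linarith)]; ring) s hs hsP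
  have hc1 : Commute h (g' ^ n) := by
    rcases hh' with rfl | rfl
    · exact hcomm
    · simpa using hcomm.inv_left
  have hc2 : Commute h (g ^ n) := by
    rcases hg' with rfl | rfl
    · exact hc1
    · simpa using hc1.inv_right
  refine ⟨n, n, hn, hn, ?_⟩
  rw [hc2.eq, mul_inv_cancel_right]
end
end

section
/- Let G be a finitely generated group which is not virtually cyclic, and let P be a collection of subgroups of G. If G admits an isometric action on a Gromov hyperbolic space with at least one WPD element such that each subgroup in P has bounded orbits, then there exists an element g of G which is nowhere elliptic in ZP-trees. -/
noncomputable section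

open Metric Set

universe u v

section Nowhere

variable {G : Type u} [Group G]

/-- A subgroup is `P`-elementary if it is virtually cyclic (possibly finite) or
conjugate into a subgroup in `P`. -/
def PElementary (P : Set (Subgroup G)) (H : Subgroup G) : Prop :=
  VirtuallyCyclic ↥H ∨
    ∃ p ∈ P, ∃ k : G, H ≤ Subgroup.map (MulAut.conj k).toMonoidHom p

/-- `g` is nowhere elliptic in `𝒵𝒫`-trees: `g` is not elliptic in any (nontrivial) real
`G`-tree all of whose arc stabilisers are `P`-elementary. -/
def NowhereEllipticZP (P : Set (Subgroup G)) (g : G) : Prop :=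
  ∀ (T : Type u) (_ : MetricSpace T) (ρ : G →* (T ≃ᵢ T)), IsRealTree T →
    (¬ ∃ x : T, ∀ h : G, ρ h x = x) →
    (∀ x y : T, x ≠ y → PElementary P (setStabilizer ρ (seg x y))) →
    ¬ Elliptic ρ g

end Nowhere


section TreeHyp

variable {T : Type*} [MetricSpace T]

/-- Arc from an injective 1-Lipschitz path. -/
theorem arc_of_lip (h : ℝ → T) (L : ℝ) (hL : 0 < L)
    (hlip : ∀ u ∈ Icc (0:ℝ) L, ∀ v ∈ Icc (0:ℝ) L, dist (h u) (h v) ≤ |u - v|)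
    (hinj : InjOn h (Icc 0 L)) : IsArcBetween (h 0) (h L) (h '' Icc 0 L) := by
  have hmaps : ∀ t ∈ Icc (0:ℝ) 1, L * t ∈ Icc (0:ℝ) L := by
    intro t ht
    constructor
    · exact mul_nonneg hL.le ht.1
    · nlinarith [ht.2]
  have hc : ContinuousOn h (Icc 0 L) := by
    have : LipschitzOnWith 1 h (Icc 0 L) := by
      apply LipschitzOnWith.of_dist_le_mul
      intro x hx y hy
      simpa [Real.dist_eq] using hlip x hx y hy
    exact this.continuousOn
  refine ⟨fun t => h (L * t), ?_, ?_, by simp, by simp, ?_⟩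
  · exact hc.comp (by fun_prop) hmaps
  · intro a ha b hb hab
    have := hinj (hmaps a ha) (hmaps b hb) hab
    exact mul_left_cancel₀ hL.ne' this
  · ext z
    constructor
    · rintro ⟨s, hs, rfl⟩
      refine ⟨s / L, ⟨div_nonneg hs.1 hL.le, (div_le_one hL).2 hs.2⟩, ?_⟩
      simp only
      congr 1
      field_simp
    · rintro ⟨t, ht, rfl⟩
      exact ⟨L * t, hmaps t ht, rfl⟩

def GeoOn (f : ℝ → T) (L : ℝ) : Prop :=
  ∀ s ∈ Icc (0:ℝ) L, ∀ t ∈ Icc (0:ℝ) L, dist (f s) (f t) = |s - t|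

theorem GeoOn.arc {f : ℝ → T} {L s : ℝ} (hf : GeoOn f L) (hs : 0 < s) (hsL : s ≤ L) :
    IsArcBetween (f 0) (f s) (f '' Icc 0 s) := by
  have hm : ∀ u ∈ Icc (0:ℝ) s, u ∈ Icc (0:ℝ) L := fun u hu => ⟨hu.1, hu.2.trans hsL⟩
  apply arc_of_lip f s hs
  · intro u hu v hv
    exact (hf u (hm u hu) v (hm v hv)).le
  · intro u hu v hv huv
    have := hf u (hm u hu) v (hm v hv)
    rw [huv, dist_self] at this
    have := abs_eq_zero.1 this.symm
    linarith

theorem geo_agree (hT : IsRealTree T) {f g : ℝ → T} {a b s t : ℝ} (hf : GeoOn f a) (hg : GeoOn g b)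
    (h0 : f 0 = g 0) (hs : s ∈ Icc 0 a) (ht : t ∈ Icc 0 b) (hst : f s = g t) :
    s = t ∧ ∀ r ∈ Icc 0 s, f r = g r := by
  have ha : (0:ℝ) ≤ a := hs.1.trans hs.2
  have hb : (0:ℝ) ≤ b := ht.1.trans ht.2
  have h1 : s = t := by
    have e1 := hf 0 ⟨le_rfl, ha⟩ s hs
    have e2 := hg 0 ⟨le_rfl, hb⟩ t ht
    rw [h0, hst, e2] at e1
    simp only [zero_sub, abs_neg, abs_of_nonneg hs.1, abs_of_nonneg ht.1] at e1
    exact e1.symm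
  subst h1
  refine ⟨rfl, ?_⟩
  intro r hr
  rcases hs.1.eq_or_lt with h | h
  · have : r = 0 := by linarith [hr.1, hr.2]
    rw [this, h0]
  have A := hf.arc h hs.2
  have B := hg.arc h ht.2
  rw [← h0, ← hst] at B
  have hAB := hT.2 _ _ _ _ A B
  have : f r ∈ g '' Icc 0 s := by rw [← hAB]; exact ⟨r, hr, rfl⟩
  obtain ⟨r', hr', he⟩ := this
  have e1 := hf 0 ⟨le_rfl, ha⟩ r ⟨hr.1, hr.2.trans hs.2⟩
  have e2 := hg 0 ⟨le_rfl, hb⟩ r' ⟨hr'.1, hr'.2.trans ht.2⟩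
  rw [h0, ← he, e2] at e1
  simp only [zero_sub, abs_neg, abs_of_nonneg hr.1, abs_of_nonneg hr'.1] at e1
  rw [← he, e1]

theorem tripod (hT : IsRealTree T) {f g : ℝ → T} {a b : ℝ} (ha : 0 ≤ a) (hb : 0 ≤ b)
    (hf : GeoOn f a) (hg : GeoOn g b) (h0 : f 0 = g 0) :
    ∃ c, 0 ≤ c ∧ c ≤ a ∧ c ≤ b ∧ (∀ r ∈ Icc 0 c, f r = g r) ∧
      dist (f a) (g b) = a + b - 2 * c := by
  have hfc : ContinuousOn f (Icc 0 (min a b)) := by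
    have : LipschitzOnWith 1 f (Icc 0 (min a b)) := by
      apply LipschitzOnWith.of_dist_le_mul
      intro x hx y hy
      simpa [Real.dist_eq] using (hf x ⟨hx.1, hx.2.trans (min_le_left _ _)⟩ y
        ⟨hy.1, hy.2.trans (min_le_left _ _)⟩).le
    exact this.continuousOn
  have hgc : ContinuousOn g (Icc 0 (min a b)) := by
    have : LipschitzOnWith 1 g (Icc 0 (min a b)) := by
      apply LipschitzOnWith.of_dist_le_mul
      intro x hx y hy
      simpa [Real.dist_eq] using (hg x ⟨hx.1, hx.2.trans (min_le_right _ _)⟩ y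
        ⟨hy.1, hy.2.trans (min_le_right _ _)⟩).le
    exact this.continuousOn
  have hd : ContinuousOn (fun s => dist (f s) (g s)) (Icc 0 (min a b)) :=
    continuous_dist.comp_continuousOn (hfc.prodMk hgc)
  have hcl : IsClosed (Icc 0 (min a b) ∩ (fun s => dist (f s) (g s)) ⁻¹' {0}) :=
    hd.preimage_isClosed_of_isClosed isClosed_Icc isClosed_singleton
  have hcomp : IsCompact (Icc 0 (min a b) ∩ (fun s => dist (f s) (g s)) ⁻¹' {0}) :=
    isCompact_Icc.of_isClosed_subset hcl inter_subset_left
  have hne : (Icc 0 (min a b) ∩ (fun s => dist (f s) (g s)) ⁻¹' {0}).Nonempty :=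
    ⟨0, ⟨le_rfl, le_min ha hb⟩, by simp [h0]⟩
  obtain ⟨c, ⟨hc, hc0⟩, hmax⟩ := hcomp.exists_isGreatest hne
  have hca : c ≤ a := hc.2.trans (min_le_left _ _)
  have hcb : c ≤ b := hc.2.trans (min_le_right _ _)
  have hfg : f c = g c := by simpa using hc0
  have hag := (geo_agree hT hf hg h0 ⟨hc.1, hca⟩ ⟨hc.1, hcb⟩ hfg).2
  refine ⟨c, hc.1, hca, hcb, hag, ?_⟩
  have hfa : dist (f a) (f c) = a - c := by
    rw [hf a ⟨ha, le_rfl⟩ c ⟨hc.1, hca⟩, abs_of_nonneg (by linarith)]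
  have hgb : dist (g c) (g b) = b - c := by
    rw [hg c ⟨hc.1, hcb⟩ b ⟨hb, le_rfl⟩, abs_of_nonpos (by linarith)]; ring
  by_cases hL : 0 < (a - c) + (b - c)
  swap
  · have e1 : a = c := by linarith
    have e2 : b = c := by linarith
    rw [e1, e2, hfg, dist_self]; ring
  set L := (a - c) + (b - c) with hLdef
  let h : ℝ → T := fun u => if u ≤ a - c then f (a - u) else g (c + (u - (a - c)))
  have hl : ∀ u, u ≤ a - c → h u = f (a - u) := fun u hu => if_pos hu
  have hr : ∀ u, a - c < u → h u = g (c + (u - (a - c))) := fun u hu => if_neg (not_le.2 hu)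
  have hmix : ∀ u v, 0 ≤ u → u ≤ a - c → a - c < v → v ≤ L → dist (h u) (h v) ≤ |u - v| := by
    intro u v hu0 hu hv hvL
    rw [hl u hu, hr v hv]
    have t1 := hf (a - u) ⟨by linarith [hc.1], by linarith⟩ c ⟨hc.1, hca⟩
    have t2 := hg c ⟨hc.1, hcb⟩ (c + (v - (a - c))) ⟨by linarith [hc.1], by linarith⟩
    rw [abs_of_nonneg (by linarith)] at t1
    rw [abs_of_nonpos (by linarith)] at t2
    have := dist_triangle (f (a - u)) (f c) (g (c + (v - (a - c))))
    rw [hfg] at this t1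
    rw [abs_of_nonpos (by linarith)]
    linarith
  have hmixinj : ∀ u v, 0 ≤ u → u ≤ a - c → a - c < v → v ≤ L → h u ≠ h v := by
    intro u v hu0 hu hv hvL he
    rw [hl u hu, hr v hv] at he
    obtain ⟨e1, _⟩ := geo_agree hT hf hg h0 (s := a - u) (t := c + (v - (a - c)))
      ⟨by linarith [hc.1], by linarith⟩ ⟨by linarith [hc.1], by linarith⟩ he
    rw [← e1] at he
    have := hmax (a := a - u) ⟨⟨by linarith [hc.1], le_min (by linarith) (by linarith)⟩,
      by simp [he]⟩
    linarith
  have hA : IsArcBetween (h 0) (h L) (h '' Icc 0 L) := by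
    apply arc_of_lip h L hL
    · intro u hu v hv
      rcases le_or_gt u (a - c) with h1 | h1 <;> rcases le_or_gt v (a - c) with h2 | h2
      · rw [hl u h1, hl v h2, hf _ ⟨by linarith [hc.1], by linarith [hu.1]⟩ _
          ⟨by linarith [hc.1], by linarith [hv.1]⟩]
        rw [show a - u - (a - v) = -(u - v) by ring, abs_neg]
      · exact hmix u v hu.1 h1 h2 hv.2
      · rw [dist_comm, abs_sub_comm]; exact hmix v u hv.1 h2 h1 hu.2
      · rw [hr u h1, hr v h2, hg _ ⟨by linarith [hc.1], by linarith [hu.2]⟩ _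
          ⟨by linarith [hc.1], by linarith [hv.2]⟩]
        rw [show c + (u - (a - c)) - (c + (v - (a - c))) = u - v by ring]
    · intro u hu v hv huv
      rcases le_or_gt u (a - c) with h1 | h1 <;> rcases le_or_gt v (a - c) with h2 | h2
      · rw [hl u h1, hl v h2] at huv
        have := hf (a - u) ⟨by linarith [hc.1], by linarith [hu.1]⟩ (a - v)
          ⟨by linarith [hc.1], by linarith [hv.1]⟩
        rw [huv, dist_self] at this
        have := abs_eq_zero.1 this.symm
        linarith
      · exact absurd huv (hmixinj u v hu.1 h1 h2 hv.2)
      · exact absurd huv.symm (hmixinj v u hv.1 h2 h1 hu.2)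
      · rw [hr u h1, hr v h2] at huv
        have := hg (c + (u - (a - c))) ⟨by linarith [hc.1], by linarith [hu.2]⟩ (c + (v - (a - c)))
          ⟨by linarith [hc.1], by linarith [hv.2]⟩
        rw [huv, dist_self] at this
        have := abs_eq_zero.1 this.symm
        linarith
  have hh0 : h 0 = f a := by rw [hl 0 (by linarith)]; simp
  have hhc : h (a - c) = f c := by rw [hl _ le_rfl]; simp
  have hhL : h L = g b := by
    rcases hcb.eq_or_lt with e | e
    · have : L = a - c := by rw [hLdef, e]; ring
      rw [this, hhc, hfg, e]
    · rw [hr L (by linarith)]; congr 1; rw [hLdef]; ring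
  rw [hh0, hhL] at hA
  have hne' : f a ≠ g b := by
    obtain ⟨k, _, hk2, hk3, hk4, _⟩ := hA
    intro he
    have := hk2 (x₁ := 0) (x₂ := 1) ⟨le_rfl, zero_le_one⟩ ⟨zero_le_one, le_rfl⟩
      (by rw [hk3, hk4, he])
    norm_num at this
  obtain ⟨k, hk0, hk1, hk⟩ := hT.1 (f a) (g b)
  have hkg : GeoOn k (dist (f a) (g b)) := hk
  have hB := hkg.arc (dist_pos.2 hne') le_rfl
  rw [hk0, hk1] at hB
  have hAB := hT.2 _ _ _ _ hA hB
  have : f c ∈ k '' Icc 0 (dist (f a) (g b)) := by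
    rw [← hAB]
    exact ⟨a - c, ⟨by linarith, by linarith⟩, hhc⟩
  obtain ⟨s, hs, hsc⟩ := this
  have k1 := hk 0 ⟨le_rfl, dist_nonneg⟩ s hs
  have k2 := hk s hs _ ⟨dist_nonneg, le_rfl⟩
  rw [hk0, hsc, abs_of_nonpos (by linarith [hs.1])] at k1
  rw [hk1, hsc, abs_of_nonpos (by linarith [hs.2])] at k2
  rw [← hfg] at hgb
  linarith

theorem tree_hyp (hT : IsRealTree T) : GromovHyperbolic T 0 := by
  intro x y z w
  obtain ⟨fx, x0, x1, hx⟩ := hT.1 w x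
  obtain ⟨fy, y0, y1, hy⟩ := hT.1 w y
  obtain ⟨fz, z0, z1, hz⟩ := hT.1 w z
  obtain ⟨c, c0, c1, c2, c3, c4⟩ := tripod hT dist_nonneg dist_nonneg hx hz (x0.trans z0.symm)
  obtain ⟨d, d0, d1, d2, d3, d4⟩ := tripod hT dist_nonneg dist_nonneg hz hy (z0.trans y0.symm)
  rw [x1, z1] at c4
  rw [y1, z1] at d4
  have hm : fx (min c d) = fy (min c d) :=
    (c3 _ ⟨le_min c0 d0, min_le_left _ _⟩).trans (d3 _ ⟨le_min c0 d0, min_le_right _ _⟩)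
  have m0 : 0 ≤ min c d := le_min c0 d0
  have mc := min_le_left c d
  have md := min_le_right c d
  have e1 := hx (min c d) ⟨m0, mc.trans c1⟩ _ ⟨dist_nonneg, le_rfl⟩
  have e2 := hy (min c d) ⟨m0, md.trans d2⟩ _ ⟨dist_nonneg, le_rfl⟩
  rw [x1, abs_of_nonpos (by linarith)] at e1
  rw [y1, abs_of_nonpos (by linarith)] at e2
  have tri := dist_triangle x (fx (min c d)) y
  rw [dist_comm x (fx _), e1] at tri
  rw [hm, e2] at tri
  rw [dist_comm z w, dist_comm x w, dist_comm y w, dist_comm y z]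
  rcases le_total c d with h | h
  · rw [min_eq_left h] at tri
    have := le_max_left (dist x z + dist w y) (dist w x + dist z y)
    linarith
  · rw [min_eq_right h] at tri
    have := le_max_right (dist x z + dist w y) (dist w x + dist z y)
    linarith

end TreeHyp

section TreeIso

variable {T : Type*} [MetricSpace T]

theorem hyp0 (hyp : GromovHyperbolic T 0) (x y z w : T) :
    dist x y + dist z w ≤ dist x z + dist y w ∨ dist x y + dist z w ≤ dist x w + dist y z := by
  have := hyp x y z w
  rw [mul_zero, add_zero] at this
  exact le_max_iff.1 this

/-- points of a segment are determined by their position; more generally initial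
parts of segments agree up to the Gromov product -/
theorem seg_uniq (hyp : GromovHyperbolic T 0) {z x y p q : T} {s : ℝ}
    (hp : dist z p = s) (hp' : dist p x = dist z x - s) (hq : dist z q = s)
    (hq' : dist q y = dist z y - s) (hs : dist x y ≤ dist z x + dist z y - 2 * s) : p = q := by
  have h1 : dist q x ≤ dist z x - s := by
    rcases hyp0 hyp q x z y with h | h
    · rw [dist_comm q z] at h; linarith
    · rw [dist_comm x z] at h; linarith
  have h2 : dist p q ≤ 0 := by
    rcases hyp0 hyp p q z x with h | h
    · rw [dist_comm p z] at h; linarith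
    · rw [dist_comm q z] at h; linarith
  exact dist_le_zero.1 h2

theorem seg_point (geo : GeodesicSpace T) (x y : T) (s : ℝ) (h0 : 0 ≤ s) (h1 : s ≤ dist x y) :
    ∃ p, dist x p = s ∧ dist p y = dist x y - s := by
  obtain ⟨f, f0, f1, hf⟩ := geo x y
  refine ⟨f s, ?_, ?_⟩
  · rw [← f0, hf 0 ⟨le_rfl, dist_nonneg⟩ s ⟨h0, h1⟩, abs_of_nonpos (by linarith)]; ring
  · conv_lhs => rw [← f1]
    rw [hf s ⟨h0, h1⟩ _ ⟨dist_nonneg, le_rfl⟩, abs_of_nonpos (by linarith)]; ring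

/-- if `f` fixes a point then it fixes the midpoint of `[z, f z]` -/
theorem fix_midpoint (hyp : GromovHyperbolic T 0) (f : T ≃ᵢ T) {a z m : T}
    (ha : f a = a) (h1 : dist z m = dist z (f z) / 2) (h2 : dist m (f z) = dist z (f z) / 2) :
    f m = m := by
  have hR : dist a (f z) = dist a z := by conv_lhs => rw [← ha, f.dist_eq]
  have hd : dist a m ≤ dist a z - dist z (f z) / 2 := by
    rcases hyp0 hyp a m z (f z) with h | h <;> linarith [dist_comm m z]
  have hd' : dist a m = dist a z - dist z (f z) / 2 := by
    have := dist_triangle a m z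
    rw [dist_comm m z] at this
    linarith
  have hfm : dist a (f m) = dist a m := by conv_lhs => rw [← ha, f.dist_eq]
  refine (seg_uniq hyp (z := a) (x := f z) (y := f z) (s := dist a m) rfl ?_ hfm ?_ ?_).symm
  · linarith
  · rw [f.dist_eq, dist_comm m z]; linarith
  · rw [dist_self]
    have := dist_triangle a m (f z)
    have := dist_nonneg (x := z) (y := f z)
    linarith

theorem common_fix (hyp : GromovHyperbolic T 0) (geo : GeodesicSpace T) (f g : T ≃ᵢ T)
    {a b z : T} (ha : f a = a) (hb : g b = b) (hz : f (g z) = z) : ∃ m, f m = m ∧ g m = m := by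
  obtain ⟨m, m1, m2⟩ := seg_point geo z (g z) (dist z (g z) / 2) (by positivity)
    (by linarith [dist_nonneg (x := z) (y := g z)])
  refine ⟨m, ?_, fix_midpoint hyp g hb m1 (by linarith)⟩
  apply fix_midpoint hyp f (a := a) (z := g z) ha
  · rw [hz, dist_comm, m2, dist_comm (g z) z]; ring
  · rw [hz, dist_comm, m1, dist_comm (g z) z]

/-- A fixed point free isometry: displacement strictly bigger than twice the product. -/
theorem nofix_prod (hyp : GromovHyperbolic T 0) (geo : GeodesicSpace T) (f : T ≃ᵢ T)
    (hf : ∀ x, f x ≠ x) (z : T) : dist z (f z) < dist z (f (f z)) := by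
  by_contra hcon
  push Not at hcon
  obtain ⟨m, m1, m2⟩ := seg_point geo z (f z) (dist z (f z) / 2) (by positivity)
    (by linarith [dist_nonneg (x := z) (y := f z)])
  apply hf m
  refine seg_uniq hyp (z := f z) (x := f (f z)) (y := z) (s := dist z (f z) / 2) ?_ ?_ ?_ ?_ ?_
  · rw [f.dist_eq, m1]
  · rw [f.dist_eq, f.dist_eq, m2]
  · rw [dist_comm, m2]; ring
  · rw [dist_comm m z, m1, dist_comm (f z) z]; ring
  · rw [f.dist_eq, dist_comm (f (f z)) z, dist_comm (f z) z]; linarith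

theorem orbit_dist_s14 (hyp : GromovHyperbolic T 0) (f : T ≃ᵢ T) (z : T)
    (hz : dist z (f z) < dist z (f (f z))) (n : ℕ) :
    dist z ((f ^ (n + 1)) z) = dist z (f z) + n * (dist z (f (f z)) - dist z (f z)) := by
  have key : ∀ n : ℕ, dist z ((f ^ (n + 1)) z) =
      dist z (f z) + n * (dist z (f (f z)) - dist z (f z)) ∧
      dist z ((f ^ (n + 2)) z) =
      dist z (f z) + (n + 1) * (dist z (f (f z)) - dist z (f z)) := by
    intro n
    induction n with
    | zero => simp [pow_two, IsometryEquiv.mul_apply]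
    | succ n ih =>
      refine ⟨by rw [ih.2]; push_cast; ring, ?_⟩
      have hs : ∀ (m : ℕ) (x : T), (f ^ m) (f x) = (f ^ (m + 1)) x := by
        intro m x; rw [pow_succ]; rfl
      have d1 : dist ((f ^ (n + 2)) z) ((f ^ (n + 3)) z) = dist z (f z) := by
        rw [← hs (n + 2), IsometryEquiv.dist_eq]
      have d2 : dist ((f ^ (n + 1)) z) ((f ^ (n + 3)) z) = dist z (f (f z)) := by
        rw [← hs (n + 2), ← hs (n + 1), IsometryEquiv.dist_eq]
      have d3 : dist ((f ^ (n + 1)) z) ((f ^ (n + 2)) z) = dist z (f z) := by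
        rw [← hs (n + 1), IsometryEquiv.dist_eq]
      have tr := dist_triangle z ((f ^ (n + 1)) z) ((f ^ (n + 3)) z)
      have e1 := ih.1
      have e2 := ih.2
      have hn : (0:ℝ) ≤ n := Nat.cast_nonneg n
      set A := dist z (f z)
      set B := dist z (f (f z))
      have hup : dist z ((f ^ (n + 3)) z) ≤ A + (n + 1 + 1) * (B - A) := by
        rcases hyp0 hyp z ((f ^ (n + 3)) z) ((f ^ (n + 1)) z) ((f ^ (n + 2)) z) with h | h
        · rw [dist_comm ((f ^ (n + 3)) z)] at h
          nlinarith
        · rw [dist_comm ((f ^ (n + 3)) z)] at h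
          nlinarith
      have hlo : A + (n + 1 + 1) * (B - A) ≤ dist z ((f ^ (n + 3)) z) := by
        rcases hyp0 hyp z ((f ^ (n + 2)) z) ((f ^ (n + 1)) z) ((f ^ (n + 3)) z) with h | h
        · nlinarith
        · rw [dist_comm ((f ^ (n + 2)) z) ((f ^ (n + 1)) z)] at h
          linarith
      have : n + 1 + 2 = n + 3 := rfl
      rw [this]
      push_cast
      linarith
  exact (key n).1

theorem orbit_shift (hyp : GromovHyperbolic T 0) (f : T ≃ᵢ T) (z : T) {r l : ℝ} (hl : 0 < l)
    (h : ∀ n : ℕ, dist z ((f ^ (n + 1)) z) = 2 * r + (n + 1) * l) {s : ℝ}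
    (hs : r ≤ s) (hs' : s ≤ r + 2 * l) {p q : T} (hp : dist z p = s)
    (hp' : dist p ((f ^ 3) z) = 2 * r + 3 * l - s)
    (hq : dist z q = s + l) (hq' : dist q ((f ^ 3) z) = 2 * r + 2 * l - s) : f p = q := by
  have h1 := h 0
  have h2 := h 1
  have h3 := h 2
  have h4 := h 3
  norm_num at h1 h2 h3 h4
  have hc : ∀ (m : ℕ) (x : T), f ((f ^ m) x) = (f ^ (m + 1)) x := by
    intro m x; rw [pow_succ']; rfl
  have k1 : dist (f z) ((f ^ 4) z) = 2 * r + 3 * l := by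
    rw [← hc 3, f.dist_eq, h3]
  have k2 : dist (f p) ((f ^ 4) z) = 2 * r + 3 * l - s := by
    rw [← hc 3, f.dist_eq, hp']
  have k3 : dist (f z) (f p) = s := by rw [f.dist_eq, hp]
  have a1 : dist z (f p) ≤ s + l := by
    rcases hyp0 hyp z (f p) (f z) ((f ^ 4) z) with h | h
    · linarith
    · rw [dist_comm (f p) (f z)] at h; linarith
  have a2 : dist (f p) ((f ^ 3) z) ≤ 2 * r + 2 * l - s := by
    rw [← hc 2, f.dist_eq]
    have k4 : dist ((f ^ 2) z) ((f ^ 3) z) = 2 * r + l := by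
      have : (f ^ 3) z = (f ^ 2) (f z) := by rw [pow_succ]; rfl
      rw [this, IsometryEquiv.dist_eq, h1]
    rcases hyp0 hyp p ((f ^ 2) z) z ((f ^ 3) z) with h | h
    · rw [dist_comm p z] at h; linarith
    · rw [dist_comm ((f ^ 2) z) z] at h; linarith
  have tr := dist_triangle z (f p) ((f ^ 3) z)
  refine seg_uniq hyp (z := z) (x := (f ^ 3) z) (y := (f ^ 3) z) (s := s + l) ?_ ?_ hq ?_ ?_
  · linarith
  · linarith
  · linarith
  · rw [dist_self]
    have := dist_nonneg (x := q) (y := (f ^ 3) z)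
    linarith

theorem transl_unique (f : T ≃ᵢ T) (z z' : T) {r l r' l' : ℝ}
    (h : ∀ n : ℕ, dist z ((f ^ (n + 1)) z) = 2 * r + (n + 1) * l)
    (h' : ∀ n : ℕ, dist z' ((f ^ (n + 1)) z') = 2 * r' + (n + 1) * l') : l ≤ l' := by
  by_contra hcon
  push Not at hcon
  obtain ⟨n, hn⟩ := exists_nat_gt ((2 * dist z z' + 2 * r' - 2 * r) / (l - l'))
  rw [div_lt_iff₀ (by linarith)] at hn
  have e := h n
  have e' := h' n
  have t1 := dist_triangle4 z z' ((f ^ (n + 1)) z') ((f ^ (n + 1)) z)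
  rw [IsometryEquiv.dist_eq, dist_comm z' z] at t1
  nlinarith

/-- Key tree lemma. -/
theorem tree_key (hyp : GromovHyperbolic T 0) (geo : GeodesicSpace T) (e f k : T ≃ᵢ T)
    (hf : ∀ x, f x ≠ x) (hk : f = k * e⁻¹ * k⁻¹) {z : T} (hz : (e ^ 3) ((f ^ 3) z) = z) :
    ∃ x y : T, x ≠ y ∧ ∀ p ∈ seg x y, e (f p) = p ∧ f (e p) = p := by
  have he : ∀ x, e⁻¹ x ≠ x := by
    intro x hx
    apply hf (k x)
    rw [hk]
    simp [IsometryEquiv.mul_apply, hx]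
  have hA := nofix_prod hyp geo f hf z
  have hB := nofix_prod hyp geo e⁻¹ he z
  have oA := orbit_dist_s14 hyp f z hA
  have oB := orbit_dist_s14 hyp e⁻¹ z hB
  obtain ⟨l, hl⟩ : ∃ l, l = dist z (f (f z)) - dist z (f z) := ⟨_, rfl⟩
  obtain ⟨l', hl'⟩ : ∃ l, l = dist z (e⁻¹ (e⁻¹ z)) - dist z (e⁻¹ z) := ⟨_, rfl⟩
  obtain ⟨r, hr⟩ : ∃ r, r = (dist z (f z) - l) / 2 := ⟨_, rfl⟩
  obtain ⟨r', hr'⟩ : ∃ r, r = (dist z (e⁻¹ z) - l') / 2 := ⟨_, rfl⟩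
  have oA' : ∀ n : ℕ, dist z ((f ^ (n + 1)) z) = 2 * r + (n + 1) * l := by
    intro n; rw [oA n, ← hl, hr]; ring
  have oB' : ∀ n : ℕ, dist z ((e⁻¹ ^ (n + 1)) z) = 2 * r' + (n + 1) * l' := by
    intro n; rw [oB n, ← hl', hr']; ring
  have hfk : ∀ n : ℕ, (f ^ n) (k z) = k ((e⁻¹ ^ n) z) := by
    intro n
    rw [hk, conj_pow]
    simp [IsometryEquiv.mul_apply]
  have oC : ∀ n : ℕ, dist (k z) ((f ^ (n + 1)) (k z)) = 2 * r' + (n + 1) * l' := by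
    intro n
    rw [hfk, IsometryEquiv.dist_eq, oB' n]
  have hll : l = l' := le_antisymm (transl_unique f z (k z) oA' oC) (transl_unique f (k z) z oC oA')
  subst hll
  have hz' : (f ^ 3) z = (e⁻¹ ^ 3) z := by
    conv_rhs => rw [← hz]
    rw [← IsometryEquiv.mul_apply, inv_pow, inv_mul_cancel]; rfl
  have h3A := oA' 2
  have h3B := oB' 2
  norm_num at h3A h3B
  have hrr : r = r' := by
    rw [hz'] at h3A; rw [inv_pow] at h3A; linarith
  subst hrr
  have hl0 : 0 < l := by linarith
  have hr0 : 0 ≤ r := by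
    have := dist_triangle z (f z) (f (f z))
    rw [f.dist_eq] at this
    rw [hr, hl]; linarith
  obtain ⟨x, x1, x2⟩ := seg_point geo z ((f ^ 3) z) (r + l) (by linarith) (by linarith)
  obtain ⟨y, y1, y2⟩ := seg_point geo z ((f ^ 3) z) (r + 2 * l) (by linarith) (by linarith)
  refine ⟨x, y, ?_, ?_⟩
  · intro hxy; rw [hxy] at x1; linarith
  intro p hp
  have hxy : dist x y = l := by
    apply le_antisymm
    · rcases hyp0 hyp x y z ((f ^ 3) z) with h | h
      · rw [dist_comm x z] at h; linarith
      · rw [dist_comm y z] at h; linarith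
    · have := dist_triangle z x y; linarith
  have hp' : dist x p + dist p y = l := by rw [← hxy]; exact hp
  have t1 := dist_triangle z x p
  have t2 := dist_triangle p y ((f ^ 3) z)
  have t3 := dist_triangle z p ((f ^ 3) z)
  have t4 := dist_triangle z p y
  have p1 : dist z p = r + l + dist x p := by linarith
  have p2 : dist p ((f ^ 3) z) = 2 * r + 3 * l - (r + l + dist x p) := by linarith
  have dn := dist_nonneg (x := x) (y := p)
  have dn' := dist_nonneg (x := p) (y := y)
  obtain ⟨q, q1, q2⟩ := seg_point geo z ((f ^ 3) z) (r + l + dist x p + l)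
    (by linarith) (by linarith)
  obtain ⟨o, o1, o2⟩ := seg_point geo z ((f ^ 3) z) (r + dist x p)
    (by linarith) (by linarith)
  have A1 : f p = q := orbit_shift hyp f z hl0 oA' (s := r + l + dist x p) (by linarith)
    (by linarith) p1 p2 q1 (by linarith)
  have A2 : e⁻¹ p = q := orbit_shift hyp e⁻¹ z hl0 oB' (s := r + l + dist x p) (by linarith)
    (by linarith) p1 (by rw [← hz', p2]) q1 (by rw [← hz', q2]; linarith)
  have A3 : f o = p := orbit_shift hyp f z hl0 oA' (s := r + dist x p) (by linarith)
    (by linarith) o1 (by linarith) (by linarith) (by linarith)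
  have A4 : e⁻¹ o = p := orbit_shift hyp e⁻¹ z hl0 oB' (s := r + dist x p) (by linarith)
    (by linarith) o1 (by rw [← hz']; linarith) (by linarith) (by rw [← hz']; linarith)
  have ee : ∀ u v : T, e⁻¹ u = v → e v = u := by
    intro u v h
    rw [← h, ← IsometryEquiv.mul_apply, mul_inv_cancel]; rfl
  refine ⟨?_, ?_⟩
  · rw [A1]; exact ee _ _ A2
  · rw [ee _ _ A4, A3]

theorem nofix_pow (hyp : GromovHyperbolic T 0) (geo : GeodesicSpace T) (f : T ≃ᵢ T)
    (hf : ∀ x, f x ≠ x) (n : ℕ) (hn : n ≠ 0) (z : T) : (f ^ n) z ≠ z := by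
  obtain ⟨m, rfl⟩ := Nat.exists_eq_succ_of_ne_zero hn
  have h := nofix_prod hyp geo f hf z
  have := orbit_dist_s14 hyp f z h m
  intro h0
  rw [Nat.succ_eq_add_one] at h0
  rw [h0, dist_self] at this
  have h1 : 0 < dist z (f z) := dist_pos.2 (hf z).symm
  have : 0 ≤ (m:ℝ) * (dist z (f (f z)) - dist z (f z)) :=
    mul_nonneg (Nat.cast_nonneg _) (by linarith)
  linarith

/-- fixed sets are convex -/
theorem fix_convex (hyp : GromovHyperbolic T 0) (f : T ≃ᵢ T) {x y p : T} (hx : f x = x)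
    (hy : f y = y) (hp : p ∈ seg x y) : f p = p := by
  have hp' : dist x p + dist p y = dist x y := hp
  have e1 : dist x (f p) = dist x p := by conv_lhs => rw [← hx, f.dist_eq]
  have e2 : dist (f p) y = dist p y := by conv_lhs => rw [← hy, f.dist_eq]
  refine seg_uniq hyp (z := x) (x := y) (y := y) (s := dist x p) e1 ?_ rfl ?_ ?_
  · linarith
  · linarith
  · rw [dist_self]; linarith [dist_nonneg (x := p) (y := y)]

theorem median (hyp : GromovHyperbolic T 0) (geo : GeodesicSpace T) (x y z : T) :
    ∃ m, m ∈ seg x y ∧ m ∈ seg x z ∧ m ∈ seg y z := by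
  have t1 := dist_triangle x y z
  have t2 := dist_triangle x z y
  have t3 := dist_triangle y x z
  rw [dist_comm z y] at t2
  rw [dist_comm y x] at t3
  obtain ⟨m, m1, m2⟩ := seg_point geo x y ((dist x y + dist x z - dist y z) / 2)
    (by linarith) (by linarith)
  have h : dist m z ≤ dist x z - (dist x y + dist x z - dist y z) / 2 := by
    rcases hyp0 hyp m z x y with h | h
    · rw [dist_comm m x, dist_comm z y] at h; linarith
    · rw [dist_comm z x] at h; linarith
  have s1 := dist_triangle x m z
  have s2 := dist_triangle y m z
  rw [dist_comm y m] at s2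
  refine ⟨m, ?_, ?_, ?_⟩
  · show dist x m + dist m y = dist x y; linarith
  · show dist x m + dist m z = dist x z; linarith
  · show dist y m + dist m z = dist y z; rw [dist_comm y m]; linarith

end TreeIso

theorem growth_aux {b L : ℝ} (hb : 1 ≤ b) {m : ℝ} (hm : b + 1 ≤ m)
    (h : ∀ k : ℕ, m ^ k ≤ 2 * k * L + b ^ k * L) : False := by
  have hL : 0 ≤ L := by have := h 0; simp at this; linarith
  have hc : (1:ℝ) < m / b := by rw [lt_div_iff₀ (by linarith)]; linarith
  have t1 := tendsto_pow_const_div_const_pow_of_one_lt 1 hc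
  have t0 := tendsto_pow_const_div_const_pow_of_one_lt 0 hc
  have t := (t1.const_mul (2 * L)).add (t0.const_mul L)
  simp only [mul_zero, add_zero] at t
  obtain ⟨k, hk⟩ := (t.eventually (gt_mem_nhds (zero_lt_one))).exists
  have hp : 0 < (m / b) ^ k := by positivity
  have hbk : 1 ≤ b ^ k := one_le_pow₀ hb
  have e : 2 * L * ((k:ℝ) ^ 1 / (m / b) ^ k) + L * ((k:ℝ) ^ 0 / (m / b) ^ k)
      = (2 * L * k + L) / (m / b) ^ k := by
    rw [pow_one, pow_zero]; ring
  rw [e, div_lt_one hp, div_pow, lt_div_iff₀ (by linarith)] at hk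
  have := h k
  have h2 : 2 * k * L ≤ 2 * k * L * b ^ k := le_mul_of_one_le_right (by positivity) hbk
  nlinarith

theorem conj_zpow_iter {G : Type*} [Group G] {g u : G} {n m : ℤ}
    (h : g * u ^ n * g⁻¹ = u ^ m) (k : ℕ) :
    g ^ k * u ^ (n ^ k) * (g ^ k)⁻¹ = u ^ (m ^ k) := by
  induction k with
  | zero => simp
  | succ k ih =>
    rw [pow_succ m k, zpow_mul, ← ih, conj_zpow, ← zpow_mul, mul_comm (n ^ k) m, zpow_mul, ← h,
      conj_zpow, ← zpow_mul, pow_succ g k, pow_succ' n k]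
    group

theorem growth {G : Type*} [Group G] (l : G → ℝ) (hmul : ∀ a b, l (a * b) ≤ l a + l b)
    (hinv : ∀ a, l a⁻¹ = l a) (h0 : l 1 = 0) {u : G} (hu : ∀ n : ℤ, |(n:ℝ)| ≤ l (u ^ n)) {g : G}
    {n m : ℤ} (hn : n ≠ 0) (h : g * u ^ n * g⁻¹ = u ^ m) : |m| ≤ |n| := by
  by_contra hcon
  push Not at hcon
  have hpow : ∀ (a : G) (k : ℕ), l (a ^ k) ≤ k * l a := by
    intro a k
    induction k with
    | zero => simp [h0]
    | succ k ih => rw [pow_succ]; push_cast; linarith [hmul (a ^ k) a]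
  have hz : ∀ (a : G) (k : ℤ), l (a ^ k) ≤ |(k:ℝ)| * l a := by
    intro a k
    obtain ⟨k, rfl | rfl⟩ := k.eq_nat_or_neg
    · simpa using hpow a k
    · simpa [hinv] using hpow a k
  have hnn : ∀ a, 0 ≤ l a := fun a => by
    have := hmul a a⁻¹
    rw [mul_inv_cancel, h0, hinv] at this
    linarith
  refine growth_aux (b := |(n:ℝ)|) (m := |(m:ℝ)|) (L := l g + l u) ?_ ?_ ?_
  · exact_mod_cast Int.one_le_abs hn
  · exact_mod_cast hcon
  · intro k
    have h1 := hu (m ^ k)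
    rw [← conj_zpow_iter h k] at h1
    have h2 := hmul (g ^ k * u ^ (n ^ k)) (g ^ k)⁻¹
    have h3 := hmul (g ^ k) (u ^ (n ^ k))
    have h4 := hz u (n ^ k)
    have h5 := hpow g k
    rw [hinv] at h2
    push_cast at h1 h4
    rw [abs_pow] at h1 h4
    have : 0 ≤ |(n:ℝ)| ^ k * l g := mul_nonneg (by positivity) (hnn g)
    have : 0 ≤ k * l u := mul_nonneg (by positivity) (hnn u)
    nlinarith

theorem growth_eq {G : Type*} [Group G] (l : G → ℝ) (hmul : ∀ a b, l (a * b) ≤ l a + l b)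
    (hinv : ∀ a, l a⁻¹ = l a) (h0 : l 1 = 0) {u : G} (hu : ∀ n : ℤ, |(n:ℝ)| ≤ l (u ^ n)) {g : G}
    {n m : ℤ} (hn : n ≠ 0) (h : g * u ^ n * g⁻¹ = u ^ m) : m = n ∨ m = -n := by
  have h1 := growth l hmul hinv h0 hu hn h
  have hm : m ≠ 0 := by
    rintro rfl
    rw [zpow_zero] at h
    have : u ^ n = 1 := by
      have := congrArg (fun x => g⁻¹ * x * g) h
      simpa [mul_assoc] using this
    have h2 := hu n
    rw [this, h0] at h2
    have := abs_nonpos_iff.1 h2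
    exact hn (by exact_mod_cast this)
  have h2 := growth l hmul hinv h0 hu (g := g⁻¹) hm (m := n) (by rw [← h]; group)
  exact abs_eq_abs.1 (le_antisymm h1 h2)

section FreeG
variable {X : Type*} 
open Classical in
theorem free_norm_pow {w : FreeGroup X} (hw : w ≠ 1) (n : ℕ) : n ≤ (w ^ n).norm := by
  cases n with
  | zero => simp
  | succ n =>
    have hf := fun n => FreeGroup.reduceCyclically.reduce_flatten_replicate_succ
      (FreeGroup.isReduced_toWord (x := w)) n
    have hne : FreeGroup.reduceCyclically w.toWord ≠ [] := by
      intro h0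
      have h1 := hf 0
      have h2 := hf 1
      rw [h0] at h1 h2
      rw [← FreeGroup.toWord_pow] at h1 h2
      have : (w ^ (1 + 1)).toWord = (w ^ (0 + 1)).toWord := by
        rw [h1, h2]; simp
      have := FreeGroup.toWord_injective this
      rw [pow_succ] at this
      simp at this
      exact hw this
    have h3 := hf n
    rw [← FreeGroup.toWord_pow] at h3
    have : 1 ≤ (FreeGroup.reduceCyclically w.toWord).length :=
      Nat.one_le_iff_ne_zero.2 (by simpa using hne)
    rw [FreeGroup.norm, h3]
    simp only [List.length_append, List.length_flatten, List.map_replicate, List.sum_replicate,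
      smul_eq_mul]
    nlinarith

open Classical in
theorem free_growth {w g : FreeGroup X} (hw : w ≠ 1) {n m : ℤ} (hn : n ≠ 0)
    (h : g * w ^ n * g⁻¹ = w ^ m) : m = n ∨ m = -n := by
  refine growth_eq (fun a => (a.norm : ℝ)) ?_ ?_ ?_ ?_ hn h
  · intro a b; exact_mod_cast FreeGroup.norm_mul_le a b
  · intro a; simp
  · simp
  · intro k
    obtain ⟨k, rfl | rfl⟩ := k.eq_nat_or_neg
    · simpa using free_norm_pow hw k
    · simpa using free_norm_pow hw k

theorem free_zpow_inj {a b : FreeGroup X} {n : ℤ} (hn : n ≠ 0) (h : a ^ n = b ^ n) : a = b := by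
  exact zpow_left_injective hn h

theorem free_E {w g : FreeGroup X} (hw : w ≠ 1) {n m : ℤ} (hn : n ≠ 0)
    (h : g * w ^ n * g⁻¹ = w ^ m) : Commute g w := by
  rcases free_growth hw hn h with rfl | rfl
  · rw [← conj_zpow] at h
    have := free_zpow_inj hn h
    exact mul_inv_eq_iff_eq_mul.1 this
  · exfalso
    rw [← conj_zpow, zpow_neg, ← inv_zpow] at h
    have h1 := free_zpow_inj hn h
    have h2 : g ^ 2 * w * (g ^ 2)⁻¹ = w := by
      have : g ^ 2 * w * (g ^ 2)⁻¹ = g * (g * w * g⁻¹) * g⁻¹ := by rw [pow_two]; group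
      rw [this, h1]
      have : g * w⁻¹ * g⁻¹ = (g * w * g⁻¹)⁻¹ := by group
      rw [this, h1, inv_inv]
    have h3 : w * g ^ 2 * w⁻¹ = g ^ 2 := by
      rw [mul_inv_eq_iff_eq_mul] at h2 ⊢; exact h2.symm
    rw [← conj_pow] at h3
    have h4 : w * g * w⁻¹ = g := by
      apply free_zpow_inj (n := 2) (by norm_num)
      exact_mod_cast h3
    have h5 : g * w * g⁻¹ = w := by
      rw [mul_inv_eq_iff_eq_mul] at h4 ⊢; exact h4.symm
    rw [h5] at h1
    have : w ^ (2:ℤ) = 1 ^ (2:ℤ) := by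
      rw [one_zpow]; rw [zpow_two]; nth_rewrite 2 [h1]; simp
    exact hw (free_zpow_inj (by norm_num) this)

theorem free_comm_pow {c d : FreeGroup X} (hc : c ≠ 1) (hd : d ≠ 1) (h : Commute c d) :
    ∃ n m : ℤ, n ≠ 0 ∧ m ≠ 0 ∧ c ^ n = d ^ m := by
  let H := Subgroup.closure ({c, d} : Set (FreeGroup X))
  have hcomm : ∀ x y : H, x * y = y * x := by
    have : IsMulCommutative H := by
      apply Subgroup.isMulCommutative_closure
      rintro x (rfl | rfl) y (rfl | rfl)
      · rfl
      · exact h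
      · exact h.symm
      · rfl
    intro x y
    exact mul_comm' x y
  let E := IsFreeGroup.toFreeGroup H
  have hcF : ∀ x y : FreeGroup (IsFreeGroup.Generators H), x * y = y * x := by
    intro x y
    have := congrArg E (hcomm (E.symm x) (E.symm y))
    simpa using this
  have hsub : Subsingleton (IsFreeGroup.Generators H) := by
    constructor
    intro a b
    have := hcF (FreeGroup.of a) (FreeGroup.of b)
    classical
    have := congrArg FreeGroup.toWord this
    by_contra hab
    rw [FreeGroup.of, FreeGroup.of] at this
    simp [FreeGroup.toWord_mk, FreeGroup.reduce, hab, Ne.symm hab] at this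
  have hcyc : ∃ g : H, ∀ x : H, ∃ k : ℤ, x = g ^ k := by
    rcases isEmpty_or_nonempty (IsFreeGroup.Generators H) with he | ⟨⟨a⟩⟩
    · refine ⟨1, fun x => ⟨0, ?_⟩⟩
      apply E.injective
      exact Subsingleton.elim _ _
    · refine ⟨E.symm (FreeGroup.of a), fun x => ?_⟩
      have : E x ∈ Subgroup.zpowers (FreeGroup.of a) := by
        induction E x using FreeGroup.induction_on with
        | C1 => exact one_mem _
        | of b => rw [Subsingleton.elim b a]; exact Subgroup.mem_zpowers _
        | inv_of b hb => exact inv_mem hb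
        | mul x y hx hy => exact mul_mem hx hy
      obtain ⟨k, hk⟩ := this
      refine ⟨k, ?_⟩
      apply E.injective
      rw [map_zpow]
      simpa using hk.symm
  obtain ⟨g, hg⟩ := hcyc
  obtain ⟨i, hi⟩ := hg ⟨c, Subgroup.subset_closure (by simp)⟩
  obtain ⟨j, hj⟩ := hg ⟨d, Subgroup.subset_closure (by simp)⟩
  have hi' : c = (g : FreeGroup X) ^ i := by simpa using congrArg Subtype.val hi
  have hj' : d = (g : FreeGroup X) ^ j := by simpa using congrArg Subtype.val hj
  refine ⟨j, i, ?_, ?_, ?_⟩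
  · rintro rfl; exact hd (by simpa using hj')
  · rintro rfl; exact hc (by simpa using hi')
  · rw [hi', hj', ← zpow_mul, ← zpow_mul, mul_comm]

theorem free_of_pow {a b : X} (hab : a ≠ b) {n m : ℤ} (hn : n ≠ 0)
    (h : (FreeGroup.of a) ^ n = (FreeGroup.of b) ^ m) : False := by
  classical
  let f : FreeGroup X →* Multiplicative ℤ :=
    FreeGroup.lift (fun x => if x = a then Multiplicative.ofAdd 1 else 1)
  have := congrArg f h
  simp only [map_zpow, f, FreeGroup.lift_apply_of, if_true, if_neg hab.symm, one_zpow] at this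
  rw [← ofAdd_zsmul] at this
  have := congrArg Multiplicative.toAdd this
  simp at this
  exact hn this
end FreeG

section CombS
variable {X : Type*}

theorem not_comm_conj {c d : FreeGroup X} (h : ¬ Commute c d) :
    ¬ Commute c (d ^ 3 * c⁻¹ * (d ^ 3)⁻¹) := by
  intro hc
  have c1 : c ≠ 1 := by rintro rfl; exact h (Commute.one_left d)
  have hx : Commute c (d ^ 3 * c * (d ^ 3)⁻¹) := by
    have := hc.inv_right
    have e : (d ^ 3 * c⁻¹ * (d ^ 3)⁻¹)⁻¹ = d ^ 3 * c * (d ^ 3)⁻¹ := by group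
    rwa [e] at this
  have x1 : d ^ 3 * c * (d ^ 3)⁻¹ ≠ 1 := by
    intro h1
    rw [conj_eq_one_iff] at h1
    exact c1 h1
  obtain ⟨n, m, hn, hm, e⟩ := free_comm_pow c1 x1 hx
  rw [conj_zpow] at e
  have h3 := free_E c1 hm e.symm
  have h4 : c * d ^ 3 * c⁻¹ = d ^ 3 := by
    rw [mul_inv_eq_iff_eq_mul]; exact h3.symm
  rw [← conj_pow] at h4
  have h5 : c * d * c⁻¹ = d := by
    apply free_zpow_inj (n := 3) (by norm_num)
    exact_mod_cast h4
  exact h (mul_inv_eq_iff_eq_mul.1 h5)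

variable {T : Type*} [MetricSpace T]

def GoodArc (ψ : FreeGroup X →* (T ≃ᵢ T)) : Prop :=
  ∀ x y : T, x ≠ y → ∀ a b : FreeGroup X, a ≠ 1 → b ≠ 1 → (∀ p ∈ seg x y, ψ a p = p) →
    (∀ p ∈ seg x y, ψ b p = p) → ∃ n m : ℤ, n ≠ 0 ∧ m ≠ 0 ∧ a ^ n = b ^ m

theorem comb_core (hyp : GromovHyperbolic T 0) (geo : GeodesicSpace T)
    (ψ : FreeGroup X →* (T ≃ᵢ T)) (hg : GoodArc ψ) (e k : FreeGroup X)
    (he : ∀ x, ψ e x ≠ x) (hne : ¬ Commute e (k * e⁻¹ * k⁻¹)) (z : T) :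
    ψ (e ^ 3 * (k * e⁻¹ * k⁻¹) ^ 3) z ≠ z := by
  intro hz
  set f := k * e⁻¹ * k⁻¹ with hf
  have hfx : ∀ x, ψ f x ≠ x := by
    intro x hx
    apply he (ψ k⁻¹ x)
    have h1 : ψ k⁻¹ (ψ f x) = ψ e⁻¹ (ψ k⁻¹ x) := by
      rw [← IsometryEquiv.mul_apply, ← IsometryEquiv.mul_apply, ← map_mul, ← map_mul]
      congr 2
      rw [hf]; group
    rw [hx] at h1
    have h2 : ψ e (ψ k⁻¹ x) = ψ e (ψ e⁻¹ (ψ k⁻¹ x)) := by rw [← h1]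
    rw [h2, ← IsometryEquiv.mul_apply, ← map_mul, mul_inv_cancel, map_one]
    rfl
  obtain ⟨x, y, hxy, hp⟩ := tree_key hyp geo (ψ e) (ψ f) (ψ k) hfx (by simp [hf]) (z := z) (by
    rw [← map_pow, ← map_pow, ← IsometryEquiv.mul_apply, ← map_mul]; exact hz)
  have n1 : e * f ≠ 1 := by
    intro h
    apply hne
    rw [eq_inv_of_mul_eq_one_right h]
    exact (Commute.refl e).inv_right
  have n2 : f * e ≠ 1 := by
    intro h
    apply hne
    rw [eq_inv_of_mul_eq_one_left h]
    exact (Commute.refl e).inv_right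
  obtain ⟨n, m, hn, hm, hnm⟩ := hg x y hxy (e * f) (f * e) n1 n2
    (fun p h => by rw [map_mul]; exact (hp p h).1) (fun p h => by rw [map_mul]; exact (hp p h).2)
  have hfe : e * (f * e) ^ m * e⁻¹ = (e * f) ^ m := by
    rw [← conj_zpow]; congr 1; group
  have : e * (e * f) ^ n * e⁻¹ = (e * f) ^ m := by rw [hnm, hfe]
  have h := free_E n1 hn this
  apply hne
  have h2 : e * (e * f) = e * (f * e) := by rw [h.eq]; group
  exact mul_left_cancel h2

theorem comb (c d : FreeGroup X) (hc : c ≠ 1) (hd : d ≠ 1) : ∃ w : FreeGroup X, w ≠ 1 ∧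
    ∀ (T : Type u) (_ : MetricSpace T) (ψ : FreeGroup X →* (T ≃ᵢ T)),
      GromovHyperbolic T 0 → GeodesicSpace T → GoodArc ψ →
      ((∀ x, ψ c x ≠ x) ∨ (∀ x, ψ d x ≠ x)) → ∀ x, ψ w x ≠ x := by
  by_cases h : Commute c d
  · refine ⟨c, hc, ?_⟩
    intro T _ ψ hyp geo hg hor x hx
    rcases hor with h1 | h1
    · exact h1 x hx
    · obtain ⟨n, m, hn, hm, e⟩ := free_comm_pow hc hd h
      have e2 : c ^ (n * m.sign) = d ^ m.natAbs := by
        rw [zpow_mul, e, ← zpow_mul, Int.mul_sign_self, zpow_natCast]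
      apply nofix_pow hyp geo (ψ d) h1 m.natAbs (by simpa using hm) x
      rw [← map_pow, ← e2]
      have : c ∈ setStabilizer ψ {x} := by rintro z rfl; exact hx
      exact (zpow_mem this (n * m.sign)) x rfl
  · refine ⟨c ^ 3 * d ^ 3 * (c ^ 3)⁻¹ * (d ^ 3)⁻¹, ?_, ?_⟩
    · intro h1
      have h2 : Commute (c ^ 3) (d ^ 3) := by
        have : c ^ 3 * d ^ 3 = d ^ 3 * c ^ 3 := by
          rw [mul_inv_eq_one, mul_inv_eq_iff_eq_mul] at h1; exact h1
        exact this
      apply not_comm_conj h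
      have h3 : d ^ 3 * c⁻¹ * (d ^ 3)⁻¹ = c⁻¹ := by
        apply free_zpow_inj (n := 3) (by norm_num)
        rw [conj_zpow]
        rw [mul_inv_eq_iff_eq_mul, inv_zpow]
        exact_mod_cast (h2.symm.inv_right).eq
      rw [h3]
      exact (Commute.refl c).inv_right
    · intro T _ ψ hyp geo hg hor x hx
      rcases hor with h1 | h1
      · apply comb_core hyp geo ψ hg c (d ^ 3) h1 (not_comm_conj h) x
        convert hx using 3
        rw [conj_pow, inv_pow]; group
      · apply comb_core hyp geo ψ hg d (c ^ 3) h1 (not_comm_conj (fun h' => h h'.symm)) x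
        have : d ^ 3 * (c ^ 3 * d⁻¹ * (c ^ 3)⁻¹) ^ 3
            = (c ^ 3 * d ^ 3 * (c ^ 3)⁻¹ * (d ^ 3)⁻¹)⁻¹ := by
          rw [conj_pow, inv_pow]; group
        rw [this]
        have : c ^ 3 * d ^ 3 * (c ^ 3)⁻¹ * (d ^ 3)⁻¹ ∈
          setStabilizer ψ {x} := by rintro z rfl; exact hx
        exact (inv_mem this) x rfl

theorem comb_list (A : List (FreeGroup X)) (hA : ∀ a ∈ A, a ≠ 1) (a0 : FreeGroup X)
    (h0 : a0 ≠ 1) : ∃ w : FreeGroup X, w ≠ 1 ∧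
    ∀ (T : Type u) (_ : MetricSpace T) (ψ : FreeGroup X →* (T ≃ᵢ T)),
      GromovHyperbolic T 0 → GeodesicSpace T → GoodArc ψ →
      (∃ a ∈ A, ∀ x, ψ a x ≠ x) → ∀ x, ψ w x ≠ x := by
  induction A with
  | nil => exact ⟨a0, h0, by simp⟩
  | cons b A ih =>
    obtain ⟨w, hw, h⟩ := ih (fun a ha => hA a (List.mem_cons_of_mem _ ha))
    obtain ⟨w', hw', h'⟩ := comb.{u} b w (hA b List.mem_cons_self) hw
    refine ⟨w', hw', ?_⟩
    intro T _ ψ hyp geo hg ⟨a, ha, hx⟩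
    apply h' T _ ψ hyp geo hg
    rcases List.mem_cons.1 ha with rfl | ha
    · exact Or.inl hx
    · exact Or.inr (h T _ ψ hyp geo hg ⟨a, ha, hx⟩)
end CombS

theorem tree_step {G : Type*} [Group G] {X : Type*} {T : Type*} [MetricSpace T]
    (hyp : GromovHyperbolic T 0) (geo : GeodesicSpace T) (ρ : G →* (T ≃ᵢ T))
    (φ : FreeGroup X →* G) (hg : GoodArc (ρ.comp φ)) (S : Set G)
    (hS : Subgroup.closure S = ⊤) (i j : X) (hij : i ≠ j)
    (hSj : ∀ s ∈ S, ∃ a b : X, a ≠ b ∧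
      (φ (FreeGroup.of a) = s * φ (FreeGroup.of i) * s⁻¹ ∨
        φ (FreeGroup.of a) = (s * φ (FreeGroup.of i) * s⁻¹)⁻¹) ∧
      (φ (FreeGroup.of b) = s * φ (FreeGroup.of j) * s⁻¹ ∨
        φ (FreeGroup.of b) = (s * φ (FreeGroup.of j) * s⁻¹)⁻¹))
    (hnf : ¬ ∃ x : T, ∀ h : G, ρ h x = x)
    (h1 : ∀ a : X, ∃ x, ρ.comp φ (FreeGroup.of a) x = x)
    (h2 : ∀ a b : X, a ≠ b → ∃ x, ρ.comp φ (FreeGroup.of a * FreeGroup.of b) x = x) :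
    False := by
  set ψ := ρ.comp φ with hψ
  have hex : ∀ a b, a ≠ b → ∃ m, ψ (FreeGroup.of a) m = m ∧ ψ (FreeGroup.of b) m = m := by
    intro a b hab
    obtain ⟨x, hx⟩ := h1 a
    obtain ⟨y, hy⟩ := h1 b
    obtain ⟨z, hz⟩ := h2 a b hab
    rw [map_mul] at hz
    exact common_fix hyp geo _ _ hx hy hz
  have huq : ∀ a b, a ≠ b → ∀ m m', ψ (FreeGroup.of a) m = m → ψ (FreeGroup.of b) m = m →
      ψ (FreeGroup.of a) m' = m' → ψ (FreeGroup.of b) m' = m' → m = m' := by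
    intro a b hab m m' e1 e2 e3 e4
    by_contra hne
    obtain ⟨n, k, hn, hk, e⟩ := hg m m' hne (FreeGroup.of a) (FreeGroup.of b)
      (FreeGroup.of_ne_one a) (FreeGroup.of_ne_one b)
      (fun p hp => fix_convex hyp _ e1 e3 hp) (fun p hp => fix_convex hyp _ e2 e4 hp)
    exact free_of_pow hab hn e
  obtain ⟨p, pi, pj⟩ := hex i j hij
  have hall : ∀ a, ψ (FreeGroup.of a) p = p := by
    intro a
    by_cases ai : a = i
    · rw [ai, pi]
    by_cases aj : a = j
    · rw [aj, pj]
    obtain ⟨q1, q1a, q1i⟩ := hex a i ai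
    obtain ⟨q2, q2a, q2j⟩ := hex a j aj
    obtain ⟨m, m1, m2, m3⟩ := median hyp geo q1 q2 p
    have ma := fix_convex hyp _ q1a q2a m1
    have mi := fix_convex hyp _ q1i pi m2
    have mj := fix_convex hyp _ q2j pj m3
    rw [huq i j hij p m pi pj mi mj]
    exact ma
  apply hnf
  refine ⟨p, ?_⟩
  have hstab : Subgroup.closure S ≤ setStabilizer ρ {p} := by
    rw [Subgroup.closure_le]
    rintro s hs z rfl
    obtain ⟨a, b, hab, ha, hb⟩ := hSj s hs
    have key : ∀ c d : X, (φ (FreeGroup.of c) = s * φ (FreeGroup.of d) * s⁻¹ ∨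
        φ (FreeGroup.of c) = (s * φ (FreeGroup.of d) * s⁻¹)⁻¹) →
        ψ (FreeGroup.of c) (ρ s z) = ρ s z := by
      intro c d hcd
      have hd : φ (FreeGroup.of d) ∈ setStabilizer ρ {z} := by
        rintro _ rfl; exact hall d
      have hmem : s * φ (FreeGroup.of d) * s⁻¹ ∈ setStabilizer ρ {ρ s z} := by
        rintro _ rfl
        rw [map_mul, map_mul, IsometryEquiv.mul_apply, IsometryEquiv.mul_apply]
        have : ρ s⁻¹ (ρ s z) = z := by
          rw [← IsometryEquiv.mul_apply, ← map_mul]; simp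
        rw [this, hd z rfl]
      rcases hcd with h | h
      · rw [← h] at hmem; exact hmem _ rfl
      · have := inv_mem hmem
        rw [← h] at this; exact this _ rfl
    exact huq a b hab _ _ (key a i ha) (key b j hb) (hall a) (hall b)
  intro h
  have : h ∈ Subgroup.closure S := by rw [hS]; trivial
  exact hstab this p rfl

/-- common powers in virtually cyclic groups -/
theorem vc_common {H : Type*} [Group H] (hv : VirtuallyCyclic H) (a b : H)
    (ha : ∀ n : ℤ, n ≠ 0 → a ^ n ≠ 1) (hb : ∀ n : ℤ, n ≠ 0 → b ^ n ≠ 1) :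
    ∃ n m : ℤ, n ≠ 0 ∧ m ≠ 0 ∧ a ^ n = b ^ m := by
  obtain ⟨K, hK, ⟨g, hg⟩⟩ := hv
  obtain ⟨i, i0, -, hi⟩ := Subgroup.exists_pow_mem_of_index_ne_zero hK.index_ne_zero a
  obtain ⟨j, j0, -, hj⟩ := Subgroup.exists_pow_mem_of_index_ne_zero hK.index_ne_zero b
  obtain ⟨k, hk⟩ := hg ⟨_, hi⟩
  obtain ⟨l, hl⟩ := hg ⟨_, hj⟩
  have hk' : (g : H) ^ k = a ^ i := by simpa using congrArg Subtype.val hk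
  have hl' : (g : H) ^ l = b ^ j := by simpa using congrArg Subtype.val hl
  have k0 : k ≠ 0 := by
    rintro rfl
    apply ha i (by omega)
    simpa using hk'.symm
  have l0 : l ≠ 0 := by
    rintro rfl
    apply hb j (by omega)
    simpa using hl'.symm
  refine ⟨i * l, j * k, mul_ne_zero (by omega) l0, mul_ne_zero (by omega) k0, ?_⟩
  rw [zpow_mul, zpow_mul, zpow_natCast, zpow_natCast, ← hk', ← hl', ← zpow_mul, ← zpow_mul, mul_comm]

open Classical in
theorem good_arc {G : Type*} [Group G] {X : Type*} {T : Type*} [MetricSpace T]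
    (ρ : G →* (T ≃ᵢ T)) (φ : FreeGroup X →* G) (P : Set (Subgroup G))
    {Y : Type*} [MetricSpace Y] (σ : G →* (Y ≃ᵢ Y))
    (hP : ∀ p ∈ P, ∀ y : Y, Bornology.IsBounded ((fun h : G => σ h y) '' (p : Set G)))
    (y : Y) (hφ : ∀ w : FreeGroup X, (w.norm : ℝ) ≤ dist y (σ (φ w) y))
    (hT : ∀ x y : T, x ≠ y → PElementary P (setStabilizer ρ (seg x y))) :
    GoodArc (ρ.comp φ) := by
  intro x x' hx a b ha hb hpa hpb
  have hinj : ∀ w, φ w = 1 → w = 1 := by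
    intro w hw
    have := hφ w
    rw [hw, map_one] at this
    simp at this
    rw [← FreeGroup.norm_eq_zero]
    have h0 : (w.norm : ℝ) ≤ 0 := by simpa using this
    exact Nat.le_zero.1 (by exact_mod_cast h0)
  have hinj2 : ∀ c : FreeGroup X, c ≠ 1 → ∀ n : ℤ, n ≠ 0 → c ^ n ≠ 1 := by
    intro c hc n hn h
    exact hc (free_zpow_inj hn (by rw [h, one_zpow]))
  have ma : φ a ∈ setStabilizer ρ (seg x x') := hpa
  have mb : φ b ∈ setStabilizer ρ (seg x x') := hpb
  rcases hT x x' hx with h | ⟨p, hp, k, hk⟩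
  · have hh : ∀ (c : FreeGroup X) (mc : φ c ∈ setStabilizer ρ (seg x x')), c ≠ 1 →
        ∀ n : ℤ, n ≠ 0 → (⟨φ c, mc⟩ : setStabilizer ρ (seg x x')) ^ n ≠ 1 := by
      intro c mc hc n hn h
      have h' := congrArg Subtype.val h
      simp only [SubgroupClass.coe_zpow, OneMemClass.coe_one] at h'
      rw [← map_zpow] at h'
      exact hinj2 c hc n hn (hinj _ h')
    obtain ⟨n, m, hn, hm, e⟩ := vc_common h ⟨φ a, ma⟩ ⟨φ b, mb⟩ (hh a ma ha) (hh b mb hb)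
    refine ⟨n, m, hn, hm, ?_⟩
    have h' := congrArg Subtype.val e
    simp only [SubgroupClass.coe_zpow] at h'
    rw [← map_zpow, ← map_zpow] at h'
    have := hinj (a ^ n * (b ^ m)⁻¹) (by rw [map_mul, map_inv, h', mul_inv_cancel])
    exact mul_inv_eq_one.1 this
  · exfalso
    obtain ⟨r, hr⟩ := (hP p hp (σ k⁻¹ y)).subset_closedBall (σ k⁻¹ y)
    obtain ⟨n, hn⟩ := exists_nat_gt r
    have hmem := hk (pow_mem ma n)
    obtain ⟨q, hq, e⟩ := hmem
    have h1 := hr ⟨q, hq, rfl⟩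
    rw [Metric.mem_closedBall] at h1
    have e' : k * q * k⁻¹ = φ (a ^ n) := by rw [map_pow]; simpa using e
    have h2 := hφ (a ^ n)
    have h3 : dist (σ q (σ k⁻¹ y)) (σ k⁻¹ y) = dist y (σ (φ (a ^ n)) y) := by
      rw [← (σ k).dist_eq, ← e', map_mul, map_mul, dist_comm]
      congr 1
      rw [← IsometryEquiv.mul_apply, ← map_mul]; simp
    have h4 : (n : ℝ) ≤ (a ^ n).norm := by exact_mod_cast free_norm_pow ha n
    simp only at h1
    linarith

section HypS
variable {G : Type*} [Group G]

structure HypD (d : G → G → ℝ) (δ : ℝ) : Prop where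
  self : ∀ a, d a a = 0
  symm : ∀ a b, d a b = d b a
  tri : ∀ a b c, d a c ≤ d a b + d b c
  inv : ∀ g a b, d (g * a) (g * b) = d a b
  del : 0 ≤ δ
  four : ∀ a b c e, d a b + d c e ≤ max (d a c + d b e) (d a e + d b c) + 2 * δ

structure Axis (d : G → G → ℝ) (u : G) (C : ℝ) : Prop where
  lower : ∀ n : ℤ, |(n:ℝ)| ≤ d 1 (u ^ n)
  gpb : ∀ n m : ℕ, d 1 (u ^ n) + d 1 (u ^ m) - d 1 (u ^ (n + m)) ≤ 2 * C
  wpd : ∀ R : ℝ, ∃ N : ℕ, Set.Finite {h : G | d 1 h ≤ R ∧ d (u ^ N) (h * u ^ N) ≤ R}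

def gp (d : G → G → ℝ) (a b : G) : ℝ := (d 1 a + d 1 b - d a b) / 2

variable {d : G → G → ℝ} {δ : ℝ}

theorem HypD.one_inv (H : HypD d δ) (a : G) : d 1 a⁻¹ = d 1 a := by
  rw [← H.inv a 1 a⁻¹, H.symm]; simp

theorem HypD.eq_one (H : HypD d δ) (a b : G) : d a b = d 1 (a⁻¹ * b) := by
  rw [← H.inv a⁻¹ a b]; simp

theorem HypD.nonneg (H : HypD d δ) (a b : G) : 0 ≤ d a b := by
  have := H.tri a b a
  rw [H.self, H.symm b a] at this
  linarith

theorem HypD.one_mul (H : HypD d δ) (a b : G) : d 1 (a * b) ≤ d 1 a + d 1 b := by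
  have := H.tri 1 a (a * b)
  have h := H.inv a 1 b
  rw [mul_one] at h
  linarith

theorem HypD.gp_min (H : HypD d δ) (a b c : G) :
    gp d a b ≤ gp d a c + δ ∨ gp d b c ≤ gp d a c + δ := by
  have h := H.four a c b 1
  unfold gp
  rw [H.symm b 1, H.symm c 1, H.symm a 1, H.symm c b] at h
  rcases le_total (d a b + d 1 c) (d 1 a + d b c) with h1 | h1
  · rw [max_eq_right h1] at h; right; linarith
  · rw [max_eq_left h1] at h; left; linarith

theorem HypD.gp_comm (H : HypD d δ) (a b : G) : gp d a b = gp d b a := by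
  unfold gp; rw [H.symm a b]; ring

theorem HypD.gp_le (H : HypD d δ) (a b : G) : gp d a b ≤ d 1 a := by
  unfold gp; have := H.tri 1 a b; linarith

theorem HypD.gp_nonneg (H : HypD d δ) (a b : G) : 0 ≤ gp d a b := by
  unfold gp; have := H.tri a 1 b; rw [H.symm a 1] at this; linarith

theorem HypD.gp_lip (H : HypD d δ) (a a' b : G) : gp d a b ≤ gp d a' b + d a a' := by
  unfold gp
  have h1 := H.tri 1 a' a
  have h2 := H.tri a' a b
  rw [H.symm a' a] at h1 h2
  linarith

theorem HypD.local_global (H : HypD d δ) {ι : Type*} (f : ι → G) (r : ι → ι → Prop) (Q : ℝ)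
    (hQ : ∀ i j, r i j → gp d (f i)⁻¹ (f j) ≤ Q) (hQ0 : 0 ≤ Q)
    (hD : ∀ i, 2 * Q + 3 * δ + 1 ≤ d 1 (f i)) (L : List ι) : ∀ i, (i :: L).IsChain r →
    (L.length : ℝ) + 1 ≤ d 1 ((i :: L).map f).prod ∧
      Q + 2 * δ + 1 / 2 ≤ gp d (f i) ((i :: L).map f).prod := by
  have hδ := H.del
  induction L with
  | nil =>
    intro i _
    have h := hD i
    simp only [List.map_cons, List.map_nil, List.prod_cons, List.prod_nil, mul_one,
      List.length_nil, Nat.cast_zero, zero_add]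
    refine ⟨by linarith, ?_⟩
    unfold gp
    rw [H.self]
    linarith
  | cons j L ih =>
    intro i hc
    rw [List.isChain_cons_cons] at hc
    obtain ⟨h1, h2⟩ := ih j hc.2
    have h := hD i
    have hq := hQ i j hc.1
    rw [List.map_cons, List.prod_cons]
    set p := ((j :: L).map f).prod with hp
    have e1 : d 1 (f i * p) = d (f i)⁻¹ p := by
      rw [← H.inv (f i)⁻¹]; simp
    have e2 := H.one_inv (f i)
    have e3 : d (f i) (f i * p) = d 1 p := by
      have := H.inv (f i) 1 p
      rwa [mul_one] at this
    have h3 : gp d (f i)⁻¹ p ≤ Q + δ := by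
      rcases H.gp_min (f i)⁻¹ p (f j) with h3 | h3
      · linarith
      · rw [H.gp_comm] at h3; linarith
    unfold gp at h3
    rw [List.length_cons]
    push_cast
    refine ⟨by linarith, ?_⟩
    unfold gp
    linarith

theorem HypD.pow_lin (H : HypD d δ) (w : G) (n : ℕ) : d 1 (w ^ n) ≤ n * d 1 w := by
  induction n with
  | zero => simp [H.self]
  | succ n ih => rw [pow_succ]; push_cast; linarith [H.one_mul (w ^ n) w]

theorem HypD.exists_axis1 (H : HypD d δ) (u : G) (h : d 1 u + 3 * δ + 1 ≤ d 1 (u * u)) :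
    ∃ C, (∀ n : ℤ, |(n:ℝ)| ≤ d 1 (u ^ n)) ∧
      ∀ n m : ℕ, d 1 (u ^ n) + d 1 (u ^ m) - d 1 (u ^ (n + m)) ≤ 2 * C := by
  have e0 : d u⁻¹ u = d 1 (u * u) := by rw [H.eq_one]; simp
  have e0' : d u u⁻¹ = d 1 (u * u) := by rw [H.symm, e0]
  have e1 := H.one_inv u
  set Q := gp d u⁻¹ u with hQ
  have hQ' : Q = (d 1 u + d 1 u - d 1 (u * u)) / 2 := by rw [hQ, gp, e0, e1]
  have hQ0 : 0 ≤ Q := H.gp_nonneg _ _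
  have key := fun L => H.local_global (ι := Unit) (fun _ => u) (fun _ _ => True) Q
    (by intro i j _; exact le_rfl) hQ0 (by intro i; linarith) L ()
  have key' := fun L => H.local_global (ι := Unit) (fun _ => u⁻¹) (fun _ _ => True) Q
    (by intro i j _; rw [inv_inv, H.gp_comm]) hQ0 (by intro i; linarith) L ()
  have ch : ∀ n, (List.replicate n ()).IsChain (fun _ _ => True) := by
    intro n
    apply List.isChain_replicate_of_rel
    trivial
  have kp : ∀ n : ℕ, (n:ℝ) + 1 ≤ d 1 (u ^ (n + 1)) ∧ Q + 2 * δ + 1 / 2 ≤ gp d u (u ^ (n + 1)) := by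
    intro n
    have := key (List.replicate n ()) (ch (n + 1))
    rw [← List.replicate_succ, List.map_replicate, List.prod_replicate, List.length_replicate] at this
    exact this
  have km : ∀ n : ℕ, Q + 2 * δ + 1 / 2 ≤ gp d u⁻¹ (u⁻¹ ^ (n + 1)) := by
    intro n
    have := key' (List.replicate n ()) (ch (n + 1))
    rw [← List.replicate_succ, List.map_replicate, List.prod_replicate, List.length_replicate] at this
    exact this.2
  refine ⟨Q + 2 * δ, ?_, ?_⟩
  · intro n
    have hn : ∀ n : ℕ, (n:ℝ) ≤ d 1 (u ^ n) := by
      intro n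
      cases n with
      | zero => simp [H.self]
      | succ n => push_cast; exact (kp n).1
    obtain ⟨n, rfl | rfl⟩ := n.eq_nat_or_neg
    · simpa using hn n
    · simpa [H.one_inv] using hn n
  · intro n m
    have hδ := H.del
    cases n with
    | zero => simp [H.self]; linarith
    | succ n =>
    cases m with
    | zero => simp [H.self]; linarith
    | succ m =>
      have k1 := (kp m).2
      have k2 := km n
      have e : gp d (u⁻¹ ^ (n + 1)) (u ^ (m + 1)) =
          (d 1 (u ^ (n + 1)) + d 1 (u ^ (m + 1)) - d 1 (u ^ (n + 1 + (m + 1)))) / 2 := by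
        unfold gp
        rw [inv_pow, H.one_inv, H.eq_one (u ^ (n + 1))⁻¹, inv_inv, ← pow_add]
      have : gp d (u⁻¹ ^ (n + 1)) (u ^ (m + 1)) ≤ Q + 2 * δ := by
        rcases H.gp_min u⁻¹ (u⁻¹ ^ (n + 1)) u with h1 | h1
        · linarith
        · rcases H.gp_min (u⁻¹ ^ (n + 1)) (u ^ (m + 1)) u with h2 | h2
          · linarith
          · rw [H.gp_comm] at h2; linarith
      linarith

theorem HypD.exists_pow (H : HypD d δ) (w : G) {a C : ℝ} (ha : 0 < a)
    (h : ∀ n : ℕ, a * n - C ≤ d 1 (w ^ n)) :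
    ∃ k : ℕ, 0 < k ∧ d 1 (w ^ k) + 3 * δ + 1 ≤ d 1 (w ^ k * w ^ k) := by
  by_contra hcon
  push Not at hcon
  have hb : ∀ j : ℕ, d 1 (w ^ (2 ^ j)) ≤ d 1 w + j * (3 * δ + 1) := by
    intro j
    induction j with
    | zero => simp
    | succ j ih =>
      have := hcon (2 ^ j) (by positivity)
      rw [← pow_add, ← two_mul, ← pow_succ'] at this
      push_cast
      linarith
  have t1 := tendsto_pow_const_div_const_pow_of_one_lt (r := (2:ℝ)) 1 (by norm_num)
  have t0 := tendsto_pow_const_div_const_pow_of_one_lt (r := (2:ℝ)) 0 (by norm_num)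
  have t := (t1.const_mul (3 * δ + 1)).add (t0.const_mul (d 1 w + C))
  simp only [mul_zero, add_zero] at t
  obtain ⟨k, hk⟩ := (t.eventually (gt_mem_nhds ha)).exists
  have h1 := hb k
  have h2 := h (2 ^ k)
  have e : (3 * δ + 1) * ((k:ℝ) ^ 1 / 2 ^ k) + (d 1 w + C) * ((k:ℝ) ^ 0 / 2 ^ k)
      = ((3 * δ + 1) * k + (d 1 w + C)) / 2 ^ k := by
    rw [pow_one, pow_zero]; ring
  rw [e, div_lt_iff₀ (by positivity)] at hk
  push_cast at h2
  linarith

theorem HypD.wpd_pow (H : HypD d δ) (w : G) (k : ℕ) (hk : 0 < k)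
    (h : ∀ R : ℝ, ∃ N : ℕ, Set.Finite {h : G | d 1 h ≤ R ∧ d (w ^ N) (h * w ^ N) ≤ R}) (R : ℝ) :
    ∃ N : ℕ, Set.Finite {h : G | d 1 h ≤ R ∧ d ((w ^ k) ^ N) (h * (w ^ k) ^ N) ≤ R} := by
  obtain ⟨N, hN⟩ := h (R + 2 * (k * d 1 w))
  have hw := H.nonneg 1 w
  refine ⟨N / k, hN.subset ?_⟩
  rintro g ⟨h1, h2⟩
  have hE : d ((w ^ k) ^ (N / k)) (w ^ N) ≤ k * d 1 w := by
    have e : w ^ N = (w ^ k) ^ (N / k) * w ^ (N % k) := by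
      rw [← pow_mul, ← pow_add, Nat.div_add_mod]
    rw [e, H.eq_one, inv_mul_cancel_left]
    refine (H.pow_lin w _).trans ?_
    have : ((N % k : ℕ) : ℝ) ≤ k := by exact_mod_cast (Nat.mod_lt N hk).le
    nlinarith
  refine ⟨?_, ?_⟩
  · have : 0 ≤ k * d 1 w := by positivity
    linarith
  · have t1 := H.tri (w ^ N) ((w ^ k) ^ (N / k)) (g * w ^ N)
    have t2 := H.tri ((w ^ k) ^ (N / k)) (g * (w ^ k) ^ (N / k)) (g * w ^ N)
    rw [H.inv] at t2
    rw [H.symm (w ^ N) ((w ^ k) ^ (N / k))] at t1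
    linarith

theorem Axis.pow (H : HypD d δ) {u : G} {C : ℝ} (hu : Axis d u C) (k : ℕ) (hk : 0 < k) :
    Axis d (u ^ k) C := by
  refine ⟨?_, ?_, H.wpd_pow u k hk hu.wpd⟩
  · intro n
    have := hu.lower (k * n)
    rw [zpow_mul, zpow_natCast] at this
    refine le_trans ?_ this
    push_cast
    rw [abs_mul]
    have : (1:ℝ) ≤ |(k:ℝ)| := by rw [Nat.abs_cast]; exact_mod_cast hk
    nlinarith [abs_nonneg (n:ℝ)]
  · intro n m
    have := hu.gpb (k * n) (k * m)
    rwa [← mul_add, pow_mul, pow_mul, pow_mul] at this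

theorem Axis.inv (H : HypD d δ) {u : G} {C : ℝ} (hu : Axis d u C) : Axis d u⁻¹ C := by
  refine ⟨?_, ?_, ?_⟩
  · intro n; rw [inv_zpow, H.one_inv]; exact hu.lower n
  · intro n m
    rw [inv_pow, inv_pow, inv_pow, H.one_inv, H.one_inv, H.one_inv]; exact hu.gpb n m
  · intro R
    obtain ⟨N, hN⟩ := hu.wpd R
    refine ⟨N, ?_⟩
    refine (hN.image (fun h => (u ^ N)⁻¹ * h * u ^ N)).subset ?_
    rintro h ⟨h1, h2⟩
    refine ⟨u ^ N * h * (u ^ N)⁻¹, ⟨?_, ?_⟩, by simp only; group⟩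
    · rw [inv_pow] at h2
      rw [← H.inv (u ^ N)] at h2
      simpa [mul_assoc] using h2
    · rw [inv_mul_cancel_right]
      have := H.inv (u ^ N) 1 h
      rw [mul_one] at this
      rwa [this]
end HypS

section HypS2
variable {G : Type*} [Group G] {d : G → G → ℝ} {δ : ℝ}

theorem HypD.near (H : HypD d δ) {v v' : G} {C : ℝ} (hv : Axis d v C) (hv' : Axis d v' C) (t : G)
    (h : ∀ Q : ℕ, ∃ M : ℕ, Q ≤ M ∧ (Q:ℝ) ≤ gp d (v ^ M) (t * v' ^ M)) :
    ∃ R : ℝ, ∀ n : ℕ, ∃ n' : ℕ, d (v ^ n) (t * v' ^ n') ≤ R := by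
  refine ⟨3 * d 1 v' + 5 * d 1 t + 2 * C + 4 * δ, fun n => ?_⟩
  have hδ := H.del
  have hC : 0 ≤ C := by
    have := hv.gpb 0 0
    simp [H.self] at this
    exact this
  have hs := H.nonneg 1 v'
  have ht := H.nonneg 1 t
  obtain ⟨Q, hQ⟩ := exists_nat_gt (n + d 1 (v ^ n) + d 1 t)
  obtain ⟨M, hM, hg⟩ := h Q
  have hD := H.nonneg 1 (v ^ n)
  have hMr : (Q:ℝ) ≤ M := by exact_mod_cast hM
  have hnM : n ≤ M := by
    have : (n:ℝ) ≤ M := by linarith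
    exact_mod_cast this
  have lowq : ∀ j : ℕ, d 1 (v' ^ j) - d 1 t ≤ d 1 (t * v' ^ j) := by
    intro j
    have := H.one_mul t⁻¹ (t * v' ^ j)
    rw [inv_mul_cancel_left, H.one_inv] at this
    linarith
  have hj : ∃ j : ℕ, j ≤ M ∧ |d 1 (t * v' ^ j) - d 1 (v ^ n)| ≤ d 1 v' + d 1 t := by
    by_cases h1 : d 1 (v ^ n) ≤ d 1 t
    · refine ⟨0, by omega, ?_⟩
      rw [pow_zero, mul_one, abs_of_nonneg (by linarith)]
      linarith
    · push Not at h1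
      classical
      have hPM : d 1 (v ^ n) ≤ d 1 (t * v' ^ M) := by
        have h2 := hv'.lower M
        rw [zpow_natCast] at h2
        have h3 := lowq M
        simp at h2
        have : (0:ℝ) ≤ n := Nat.cast_nonneg n
        linarith
      have hex : ∃ j : ℕ, d 1 (v ^ n) ≤ d 1 (t * v' ^ j) := ⟨M, hPM⟩
      refine ⟨Nat.find hex, Nat.find_min' hex hPM, ?_⟩
      have hf := Nat.find_spec hex
      have hmin := fun i => Nat.find_min hex (m := i)
      rw [abs_of_nonneg (by linarith)]
      cases hk : Nat.find hex with
      | zero =>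
        rw [hk, pow_zero, mul_one] at hf
        linarith
      | succ i =>
        have h2 := hmin i (by omega)
        push Not at h2
        have h3 := H.one_mul (t * v' ^ i) v'
        rw [mul_assoc, ← pow_succ] at h3
        linarith
  obtain ⟨j, hjM, hjd⟩ := hj
  refine ⟨j, ?_⟩
  rw [abs_le] at hjd
  have gpA : d 1 (v ^ n) - C ≤ gp d (v ^ n) (v ^ M) := by
    have h1 := hv.gpb n (M - n)
    have e : d (v ^ n) (v ^ M) = d 1 (v ^ (M - n)) := by
      rw [H.eq_one]; congr 1
      rw [inv_mul_eq_iff_eq_mul, ← pow_add]; congr 1; omega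
    have e2 : n + (M - n) = M := by omega
    rw [e2] at h1
    unfold gp
    rw [e]
    linarith
  have gpB : d 1 (t * v' ^ j) - d 1 t - C ≤ gp d (t * v' ^ M) (t * v' ^ j) := by
    have h1 := hv'.gpb j (M - j)
    have e : d (t * v' ^ M) (t * v' ^ j) = d 1 (v' ^ (M - j)) := by
      rw [H.inv, H.symm, H.eq_one]; congr 1
      rw [inv_mul_eq_iff_eq_mul, ← pow_add]; congr 1; omega
    have e2 : j + (M - j) = M := by omega
    rw [e2] at h1
    have h2 := lowq M
    have h3 := H.one_mul t (v' ^ j)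
    unfold gp
    rw [e]
    linarith
  have fin : d 1 (v ^ n) - d 1 v' - 2 * d 1 t - C - 2 * δ ≤ gp d (v ^ n) (t * v' ^ j) := by
    rcases H.gp_min (v ^ n) (v ^ M) (t * v' ^ j) with h1 | h1
    · linarith
    · rcases H.gp_min (v ^ M) (t * v' ^ M) (t * v' ^ j) with h2 | h2
      · have : (0:ℝ) ≤ n := Nat.cast_nonneg n
        linarith
      · linarith
  unfold gp at fin
  linarith

theorem HypD.lemW (H : HypD d δ) {v v' : G} {C : ℝ} (hv : Axis d v C) (hv' : Axis d v' C) (t : G)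
    (h : ∀ Q : ℕ, ∃ M : ℕ, Q ≤ M ∧ (Q:ℝ) ≤ gp d (v ^ M) (t * v' ^ M)) :
    ∃ a b : ℤ, a ≠ 0 ∧ b ≠ 0 ∧ t * v' ^ a * t⁻¹ = v ^ b := by
  obtain ⟨R, hR⟩ := H.near hv hv' t h
  choose ν hν using hR
  obtain ⟨N, hN⟩ := hv.wpd (2 * R)
  obtain ⟨B, hB⟩ := exists_nat_gt (2 * R + d 1 (v ^ N))
  let k : ℕ → ℤ := fun n => (ν (n + N) : ℤ) - ν n
  have hk : ∀ n, k n ∈ Set.Icc (-(B:ℤ)) B := by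
    intro n
    have h1 := hv'.lower (k n)
    have e : d (t * v' ^ ν n) (t * v' ^ ν (n + N)) = d 1 (v' ^ k n) := by
      rw [H.inv, H.eq_one]; congr 1
      rw [inv_mul_eq_iff_eq_mul, ← zpow_natCast, ← zpow_natCast, ← zpow_add]
      congr 1; simp [k]
    have t1 := H.tri (t * v' ^ ν n) (v ^ n) (t * v' ^ ν (n + N))
    have t2 := H.tri (v ^ n) (v ^ (n + N)) (t * v' ^ ν (n + N))
    have e3 : d (v ^ n) (v ^ (n + N)) = d 1 (v ^ N) := by
      rw [H.eq_one, pow_add, inv_mul_cancel_left]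
    have h2 := hν n
    have h3 := hν (n + N)
    rw [H.symm (t * v' ^ ν n) (v ^ n)] at t1
    have : |((k n : ℤ) : ℝ)| ≤ B := by linarith
    have h5 : |k n| ≤ (B:ℤ) := by exact_mod_cast this
    exact abs_le.1 h5
  obtain ⟨⟨κ, hκ⟩, hinf⟩ := Finite.exists_infinite_fiber
    (fun n : ℕ => (⟨k n, hk n⟩ : Set.Icc (-(B:ℤ)) B))
  set I : Set ℕ := (fun n : ℕ => (⟨k n, hk n⟩ : Set.Icc (-(B:ℤ)) B)) ⁻¹' {⟨κ, hκ⟩} with hI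
  have hIk : ∀ n ∈ I, k n = κ := by
    intro n hn
    have := Set.mem_singleton_iff.1 hn
    exact congrArg Subtype.val this
  have hIinf : I.Infinite := Set.infinite_coe_iff.1 hinf
  obtain ⟨m, hm⟩ := hIinf.nonempty
  let g : ℕ → G := fun n => (v ^ n)⁻¹ * t * v' ^ ν n
  have hg1 : ∀ n, d 1 (g n) ≤ R := by
    intro n
    have := hν n
    rwa [H.eq_one, ← mul_assoc] at this
  have hg2 : ∀ n ∈ I, d (v ^ N) (g n * v' ^ κ) ≤ R := by
    intro n hn
    have h1 := hν (n + N)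
    rw [← H.inv (v ^ n)]
    have e1 : v ^ n * (g n * v' ^ κ) = t * v' ^ ν (n + N) := by
      rw [← hIk n hn]
      simp only [g, k]
      rw [zpow_sub, zpow_natCast, zpow_natCast]
      have : v' ^ ν (n + N) * (v' ^ ν n)⁻¹ = (v' ^ ν n)⁻¹ * v' ^ ν (n + N) := by
        rw [← zpow_natCast, ← zpow_natCast, ← zpow_neg, ← zpow_add, ← zpow_add, add_comm]
      rw [this]
      group
    rw [e1, ← pow_add]
    exact h1
  obtain ⟨n1, hn1, n2, hn2, hne, heq⟩ := hIinf.exists_ne_map_eq_of_mapsTo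
    (f := fun n => g n * (g m)⁻¹) (t := _) (by
      intro n hn
      refine (⟨?_, ?_⟩ : _ ∧ _)
      · have := H.one_mul (g n) (g m)⁻¹
        rw [H.one_inv] at this
        linarith [hg1 n, hg1 m]
      · have h1 := H.tri (v ^ N) (g n * v' ^ κ) (g n * (g m)⁻¹ * v ^ N)
        have e : d (g n * v' ^ κ) (g n * (g m)⁻¹ * v ^ N) = d (v ^ N) (g m * v' ^ κ) := by
          rw [mul_assoc (g n) (g m)⁻¹, H.inv, ← H.inv (g m), mul_inv_cancel_left, H.symm]
        linarith [hg2 n hn, hg2 m hm]) hN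
  have heq' : g n1 = g n2 := mul_right_cancel heq
  simp only [g] at heq'
  have e : t * v' ^ ((ν n1 : ℤ) - ν n2) * t⁻¹ = v ^ ((n1:ℤ) - n2) := by
    rw [zpow_sub, zpow_sub, zpow_natCast, zpow_natCast, zpow_natCast, zpow_natCast]
    have h1 : t * v' ^ ν n1 = v ^ n1 * ((v ^ n2)⁻¹ * t * v' ^ ν n2) := by
      rw [← heq']; group
    rw [← mul_assoc, h1]
    group
  have hb : ((n1:ℤ) - n2) ≠ 0 := by
    intro h0
    apply hne
    have := sub_eq_zero.1 h0
    exact_mod_cast this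
  refine ⟨_, _, ?_, hb, e⟩
  intro h0
  rw [h0, zpow_zero, mul_one, mul_inv_cancel] at e
  have h1 := hv.lower ((n1:ℤ) - n2)
  rw [← e, H.self] at h1
  have := abs_nonpos_iff.1 h1
  exact hb (by exact_mod_cast this)

/-- `Eset u` as a subgroup. -/
def Esub (u : G) : Subgroup G where
  carrier := Eset u
  one_mem' := ⟨1, 1, by norm_num, by norm_num, by simp⟩
  mul_mem' := by
    rintro a b ⟨n, m, hn, hm, h⟩ ⟨n', m', hn', hm', h'⟩
    refine ⟨n' * n, m * m', mul_ne_zero hn' hn, mul_ne_zero hm hm', ?_⟩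
    calc a * b * u ^ (n' * n) * (a * b)⁻¹ = a * (b * (u ^ n') ^ n * b⁻¹) * a⁻¹ := by
          rw [zpow_mul]; group
      _ = a * (u ^ n) ^ m' * a⁻¹ := by
          rw [← conj_zpow, h', ← zpow_mul, ← zpow_mul, mul_comm]
      _ = u ^ (m * m') := by rw [← conj_zpow, h, zpow_mul]
  inv_mem' := by
    rintro a ⟨n, m, hn, hm, h⟩
    refine ⟨m, n, hm, hn, ?_⟩
    rw [← h]; group

theorem HypD.Emem (H : HypD d δ) {u : G} {C : ℝ} (hu : Axis d u C) {e : G} (he : e ∈ Eset u) :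
    ∃ n : ℕ, 0 < n ∧ (e * u ^ n * e⁻¹ = u ^ n ∨ e * u ^ n * e⁻¹ = (u ^ n)⁻¹) := by
  obtain ⟨n, m, hn, hm, h⟩ := he
  have hz := growth_eq (d 1) H.one_mul H.one_inv (H.self 1) hu.lower hn h
  have key : ∀ n : ℤ, n ≠ 0 → (e * u ^ n * e⁻¹ = u ^ n ∨ e * u ^ n * e⁻¹ = (u ^ n)⁻¹) →
      ∃ n : ℕ, 0 < n ∧ (e * u ^ n * e⁻¹ = u ^ n ∨ e * u ^ n * e⁻¹ = (u ^ n)⁻¹) := by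
    intro n hn h
    obtain ⟨n, rfl | rfl⟩ := n.eq_nat_or_neg
    · exact ⟨n, by omega, by simpa using h⟩
    · refine ⟨n, by omega, ?_⟩
      rw [zpow_neg, zpow_natCast, ← conj_inv, inv_inv] at h
      rcases h with h | h
      · left; exact inv_injective h
      · right; exact inv_eq_iff_eq_inv.1 h
  apply key n hn
  rcases hz with rfl | rfl
  · left; exact h
  · right; rw [h, zpow_neg]

theorem HypD.Ecommon (H : HypD d δ) {u : G} {C : ℝ} (hu : Axis d u C) {S : Set G} (hS : S.Finite)
    (hE : ∀ e ∈ S, e ∈ Eset u) :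
    ∃ n : ℕ, 0 < n ∧ ∀ e ∈ S, (e * u ^ n * e⁻¹ = u ^ n ∨ e * u ^ n * e⁻¹ = (u ^ n)⁻¹) := by
  have mono : ∀ (e : G) (n k : ℕ), (e * u ^ n * e⁻¹ = u ^ n ∨ e * u ^ n * e⁻¹ = (u ^ n)⁻¹) →
      (e * u ^ (n * k) * e⁻¹ = u ^ (n * k) ∨ e * u ^ (n * k) * e⁻¹ = (u ^ (n * k))⁻¹) := by
    intro e n k h
    rw [pow_mul, ← conj_pow, ← inv_pow]
    rcases h with h | h
    · left; rw [h]
    · right; rw [h]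
  induction S, hS using Set.Finite.induction_on with
  | empty => exact ⟨1, one_pos, by simp⟩
  | @insert a S _ _ ih =>
    obtain ⟨n, hn, h⟩ := ih (fun e he => hE e (Set.mem_insert_of_mem _ he))
    obtain ⟨m, hm, h'⟩ := H.Emem hu (hE a (Set.mem_insert _ _))
    refine ⟨n * m, Nat.mul_pos hn hm, ?_⟩
    rintro e (rfl | he)
    · rw [mul_comm]; exact mono _ _ _ h'
    · exact mono _ _ _ (h e he)
end HypS2

section HypS3
variable {G : Type*} [Group G] {d : G → G → ℝ} {δ : ℝ}

theorem HypD.vc (H : HypD d δ) {v : G} {C : ℝ} (hv : Axis d v C)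
    (hn : ∀ t : G, t * v * t⁻¹ = v ∨ t * v * t⁻¹ = v⁻¹) : VirtuallyCyclic G := by
  have hδ := H.del
  have hdisp : ∀ (t : G) (i : ℕ), d t (v ^ i * t) = d 1 (v ^ i) := by
    intro t i
    rw [H.eq_one]
    have h := hn t⁻¹
    have e : t⁻¹ * (v ^ i * t) = (t⁻¹ * v * t⁻¹⁻¹) ^ i := by rw [conj_pow]; group
    rw [e]
    rcases h with h | h
    · rw [h]
    · rw [h, inv_pow, H.one_inv]
  obtain ⟨i, hi⟩ := exists_nat_gt (2 * C + 4 * δ)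
  set a := d 1 (v ^ i) with ha
  have hai : (i:ℝ) ≤ a := by
    have := hv.lower i
    rw [zpow_natCast] at this
    simpa using this
  have hnear : ∀ t : G, ∃ j : ℤ, d (v ^ j) t ≤ a := by
    intro t
    have hfin : {j : ℤ | d (v ^ j) t ≤ d 1 t}.Finite := by
      obtain ⟨B, hB⟩ := exists_nat_gt (2 * d 1 t)
      refine (Set.finite_Icc (-(B:ℤ)) B).subset ?_
      intro j hj
      have h1 := hv.lower j
      have h2 := H.tri 1 t (v ^ j)
      rw [H.symm t] at h2
      have h3 : d (v ^ j) t ≤ d 1 t := hj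
      have : |(j:ℝ)| ≤ B := by linarith
      have h5 : |j| ≤ (B:ℤ) := by exact_mod_cast this
      exact abs_le.1 h5
    obtain ⟨j, hj, hjm⟩ := Set.exists_min_image _ (fun j : ℤ => d (v ^ j) t) hfin
      ⟨0, by simp⟩
    have hmin : ∀ k : ℤ, d (v ^ j) t ≤ d (v ^ k) t := by
      intro k
      by_cases hk : d (v ^ k) t ≤ d 1 t
      · exact hjm k hk
      · push Not at hk
        have : d (v ^ j) t ≤ d 1 t := hj
        linarith
    refine ⟨j, ?_⟩
    by_contra hcon
    push Not at hcon
    set x := (v ^ j)⁻¹ * t with hx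
    have hr : d (v ^ j) t = d 1 x := by rw [H.eq_one]
    have hmx : ∀ k : ℤ, d 1 x ≤ d (v ^ k) x := by
      intro k
      have := hmin (j + k)
      rw [hr] at this
      have e : d (v ^ k) x = d (v ^ (j + k)) t := by
        rw [← H.inv (v ^ j) (v ^ k) x, hx, mul_inv_cancel_left, ← zpow_add]
      rw [e]; exact this
    rw [hr] at hcon
    have f1 := H.four 1 (v ^ i * x) x (v ^ i)
    have e1 : d (v ^ i * x) (v ^ i) = d 1 x := by
      have := H.inv (v ^ i) x 1
      rw [mul_one] at this
      rw [this, H.symm]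
    have e2 : d (v ^ i * x) x = a := by rw [H.symm, hdisp]
    have e3 : d 1 (v ^ i * x) = d (v ^ (-(i:ℤ))) x := by
      rw [← H.inv (v ^ (-(i:ℤ))), mul_one]
      congr 1
      simp
    rw [e1, e2, e3, max_eq_left (by linarith)] at f1
    have m1 := hmx (-(i:ℤ))
    have m2 := hmx i
    rw [zpow_natCast, H.symm (v ^ i) x] at m2
    have f2 := H.four 1 x (v ^ (-(i:ℤ))) (v ^ i)
    have e4 : d (v ^ (-(i:ℤ))) (v ^ i) = d 1 (v ^ (i + i)) := by
      rw [H.eq_one, pow_add]; simp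
    have e5 : d 1 (v ^ (-(i:ℤ))) = a := by
      rw [zpow_neg, zpow_natCast, H.one_inv]
    rw [e4, e5, H.symm x (v ^ (-(i:ℤ)))] at f2
    have g := hv.gpb i i
    rcases le_total (a + d x (v ^ i)) (d 1 (v ^ i) + d (v ^ (-(i:ℤ))) x) with h | h
    · rw [max_eq_right h] at f2; linarith
    · rw [max_eq_left h] at f2; linarith
  have hplus : ∀ R : ℝ, {h : G | d 1 h ≤ R ∧ h * v * h⁻¹ = v}.Finite := by
    intro R
    obtain ⟨N, hN⟩ := hv.wpd R
    refine hN.subset ?_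
    rintro h ⟨h1, h2⟩
    refine ⟨h1, ?_⟩
    have e : h * v ^ N = v ^ N * h := by
      have : Commute h v := mul_inv_eq_iff_eq_mul.1 h2
      exact this.pow_right N
    rw [e]
    have := H.inv (v ^ N) 1 h
    rw [mul_one] at this
    rwa [this]
  have hF : {h : G | d 1 h ≤ a}.Finite := by
    have hminus : {h : G | d 1 h ≤ a ∧ h * v * h⁻¹ = v⁻¹}.Finite := by
      rcases Set.eq_empty_or_nonempty {h : G | d 1 h ≤ a ∧ h * v * h⁻¹ = v⁻¹} with h | ⟨g, g1, g2⟩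
      · rw [h]; exact Set.finite_empty
      · refine ((hplus (2 * a)).image (fun h => h * g)).subset ?_
        rintro h ⟨h1, h2⟩
        refine ⟨h * g⁻¹, ⟨?_, ?_⟩, by simp⟩
        · have := H.one_mul h g⁻¹
          rw [H.one_inv] at this
          linarith
        · have e : g⁻¹ * v * g = v⁻¹ := by
            have : g * v⁻¹ * g⁻¹ = v := by rw [← conj_inv, g2, inv_inv]
            nth_rewrite 1 [← this]
            group
          calc h * g⁻¹ * v * (h * g⁻¹)⁻¹ = h * (g⁻¹ * v * g) * h⁻¹ := by group
            _ = v := by rw [e, ← conj_inv, h2, inv_inv]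
    refine ((hplus a).union hminus).subset ?_
    intro h hh
    rcases hn h with h1 | h1
    · left; exact ⟨hh, h1⟩
    · right; exact ⟨hh, h1⟩
  refine ⟨Subgroup.zpowers v, ?_, inferInstance⟩
  have := hF.to_subtype
  have hq : Finite (G ⧸ Subgroup.zpowers v) := by
    refine Finite.of_surjective
      (fun h : {h : G | d 1 h ≤ a} => (QuotientGroup.mk (h : G)⁻¹ : G ⧸ Subgroup.zpowers v)) ?_
    intro q
    induction q using QuotientGroup.induction_on with
    | H t =>
      obtain ⟨j, hj⟩ := hnear t⁻¹
      refine ⟨⟨(v ^ j)⁻¹ * t⁻¹, ?_⟩, ?_⟩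
      · rw [H.eq_one] at hj
        exact hj
      · simp only
        rw [QuotientGroup.eq]
        refine ⟨-j, ?_⟩
        simp
  exact Subgroup.finiteIndex_of_finite_quotient

theorem HypD.exists_notE (H : HypD d δ) {u : G} {C : ℝ} (hu : Axis d u C) {S : Set G}
    (hS : S.Finite) (hSc : Subgroup.closure S = ⊤) (hnvc : ¬ VirtuallyCyclic G) :
    ∃ t, t ∉ Eset u := by
  by_contra hcon
  push Not at hcon
  apply hnvc
  obtain ⟨n, hn, h⟩ := H.Ecommon hu hS (fun e _ => hcon e)
  refine H.vc (hu.pow H n hn) ?_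
  set v := u ^ n
  intro t
  have ht : t ∈ Subgroup.closure S := by rw [hSc]; trivial
  induction ht using Subgroup.closure_induction with
  | mem x hx => exact h x hx
  | one => left; simp
  | mul x y _ _ hx hy =>
    have e : x * y * v * (x * y)⁻¹ = x * (y * v * y⁻¹) * x⁻¹ := by group
    rw [e]
    rcases hy with hy | hy
    · rw [hy]; exact hx
    · rw [hy, ← conj_inv]
      rcases hx with hx | hx
      · right; rw [hx]
      · left; rw [hx, inv_inv]
  | inv x _ hx =>
    rcases hx with hx | hx
    · left
      nth_rewrite 1 [← hx]
      group
    · right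
      have : x * v⁻¹ * x⁻¹ = v := by rw [← conj_inv, hx, inv_inv]
      nth_rewrite 1 [← this]
      group

theorem HypD.gp_left (H : HypD d δ) (x a b : G) : gp d (x * a) (x * b) ≤ gp d a b + d 1 x := by
  unfold gp
  rw [H.inv]
  have := H.one_mul x a
  have := H.one_mul x b
  linarith

open Classical in
theorem HypD.schottky (H : HypD d δ) {v : G} {C : ℝ} (hv : Axis d v C) {X : Type*} [Finite X]
    (x : X → G) (hx : ∀ i j, i ≠ j → (x i)⁻¹ * x j ∉ Eset v) :
    ∃ M : ℕ, 0 < M ∧ ∀ w : FreeGroup X,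
      (w.norm : ℝ) ≤ d 1 (FreeGroup.lift (fun i => x i * v ^ M * (x i)⁻¹) w) := by
  have := Fintype.ofFinite X
  have hδ := H.del
  have hC : 0 ≤ C := by
    have := hv.gpb 0 0
    simp [H.self] at this
    exact this
  let V : Bool → G := fun b => cond b v v⁻¹
  have hV : ∀ b, Axis d (V b) C := by
    intro b; cases b
    · exact hv.inv H
    · exact hv
  have hW : ∀ (i j : X) (b b' : Bool), ∃ Q : ℕ, i ≠ j → ∀ M : ℕ, Q ≤ M →
      gp d (V b ^ M) ((x i)⁻¹ * x j * V b' ^ M) < Q := by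
    intro i j b b'
    by_cases hij : i = j
    · exact ⟨0, fun h => absurd hij h⟩
    by_contra hcon
    push Not at hcon
    obtain ⟨p, q, hp, hq, e⟩ := H.lemW (hV b) (hV b') ((x i)⁻¹ * x j) (fun Q => (hcon Q).2)
    apply hx i j hij
    have hp' : ∃ p' : ℤ, p' ≠ 0 ∧ V b' ^ p = v ^ p' := by
      cases b'
      · exact ⟨-p, neg_ne_zero.2 hp, by simp [V]⟩
      · exact ⟨p, hp, rfl⟩
    have hq' : ∃ q' : ℤ, q' ≠ 0 ∧ V b ^ q = v ^ q' := by
      cases b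
      · exact ⟨-q, neg_ne_zero.2 hq, by simp [V]⟩
      · exact ⟨q, hq, rfl⟩
    obtain ⟨p', hp1, hp2⟩ := hp'
    obtain ⟨q', hq1, hq2⟩ := hq'
    exact ⟨p', q', hp1, hq1, by rw [← hp2, ← hq2, e]⟩
  choose Qf hQf using hW
  let Qm : ℕ := Finset.univ.sup (fun z : X × X × Bool × Bool => Qf z.1 z.2.1 z.2.2.1 z.2.2.2)
  have hQm : ∀ i j b b', Qf i j b b' ≤ Qm := fun i j b b' =>
    Finset.le_sup (f := fun z : X × X × Bool × Bool => Qf z.1 z.2.1 z.2.2.1 z.2.2.2)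
      (Finset.mem_univ (i, j, b, b'))
  let τ : ℝ := ∑ i, d 1 (x i)
  have hτ : ∀ i, d 1 (x i) ≤ τ := fun i =>
    Finset.single_le_sum (f := fun i => d 1 (x i)) (fun i _ => H.nonneg 1 (x i)) (Finset.mem_univ i)
  have hτ0 : 0 ≤ τ := Finset.sum_nonneg (fun i _ => H.nonneg 1 (x i))
  let Q : ℝ := C + Qm + 3 * τ
  have hQ0 : 0 ≤ Q := by positivity
  obtain ⟨M, hM⟩ := exists_nat_gt (Qm + (2 * Q + 3 * δ + 1 + 2 * τ))
  have hMQ : Qm ≤ M := by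
    have : (Qm:ℝ) ≤ M := by linarith
    exact_mod_cast this
  have hMpos : 0 < M := by
    have h0 : (0:ℝ) ≤ Qm := Nat.cast_nonneg _
    have : (0:ℝ) < M := by linarith
    exact_mod_cast this
  refine ⟨M, hMpos, ?_⟩
  let f : X × Bool → G := fun l => cond l.2 (x l.1 * v ^ M * (x l.1)⁻¹) (x l.1 * v ^ M * (x l.1)⁻¹)⁻¹
  have hf : ∀ i b, f (i, b) = x i * V b ^ M * (x i)⁻¹ := by
    intro i b
    cases b
    · simp only [f, V, cond_false]; rw [inv_pow, conj_inv]
    · rfl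
  have hfi : ∀ i b, (f (i, b))⁻¹ = x i * V (!b) ^ M * (x i)⁻¹ := by
    intro i b
    rw [hf, conj_inv]
    cases b <;> simp [V]
  have hVl : ∀ b, (M:ℝ) ≤ d 1 (V b ^ M) := by
    intro b
    have := (hV b).lower M
    rw [zpow_natCast] at this
    simpa using this
  have hD : ∀ l, 2 * Q + 3 * δ + 1 ≤ d 1 (f l) := by
    rintro ⟨i, b⟩
    rw [hf]
    have h1 := H.one_mul (x i)⁻¹ (x i * V b ^ M * (x i)⁻¹ * x i)
    have h2 := H.one_mul (x i * V b ^ M * (x i)⁻¹) (x i)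
    have e : (x i)⁻¹ * (x i * V b ^ M * (x i)⁻¹ * x i) = V b ^ M := by group
    rw [e, H.one_inv] at h1
    have h3 := hVl b
    have h4 := hτ i
    have h0 : (0:ℝ) ≤ Qm := Nat.cast_nonneg _
    linarith
  have hlip : ∀ (i : X) (α β : G), gp d (x i * α * (x i)⁻¹) β ≤ gp d (x i * α) β + τ := by
    intro i α β
    have h1 := H.gp_lip (x i * α * (x i)⁻¹) (x i * α) β
    have e : d (x i * α * (x i)⁻¹) (x i * α) = d 1 (x i) := by
      rw [H.eq_one]; congr 1; group
    linarith [hτ i]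
  have hr : ∀ l l' : X × Bool, (l.1 = l'.1 → l.2 = l'.2) → gp d (f l)⁻¹ (f l') ≤ Q := by
    rintro ⟨i, b⟩ ⟨j, b'⟩ hl
    simp only at hl
    rw [hfi, hf]
    have h1 := hlip i (V (!b) ^ M) (x j * V b' ^ M * (x j)⁻¹)
    have h2 := hlip j (V b' ^ M) (x i * V (!b) ^ M)
    have h3 := H.gp_left (x i) (V (!b) ^ M) ((x i)⁻¹ * x j * V b' ^ M)
    have e : x i * ((x i)⁻¹ * x j * V b' ^ M) = x j * V b' ^ M := by group
    rw [e] at h3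
    rw [H.gp_comm (x i * V (!b) ^ M) (x j * V b' ^ M * (x j)⁻¹)] at h1
    rw [H.gp_comm (x j * V b' ^ M) (x i * V (!b) ^ M)] at h2
    have h4 := hτ i
    have h5 : gp d (V (!b) ^ M) ((x i)⁻¹ * x j * V b' ^ M) ≤ C + Qm := by
      have h0 : (0:ℝ) ≤ Qm := Nat.cast_nonneg _
      by_cases hij : i = j
      · obtain rfl := hl hij
        subst hij
        rw [inv_mul_cancel, _root_.one_mul]
        have e2 : V (!b) = (V b)⁻¹ := by cases b <;> simp [V]
        have h6 := (hV b).gpb M M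
        unfold gp
        rw [e2, inv_pow, H.one_inv, H.eq_one (V b ^ M)⁻¹, inv_inv, ← pow_add]
        linarith
      · have h6 := hQf i j (!b) b' hij M ((hQm _ _ _ _).trans hMQ)
        have h7 : (Qf i j (!b) b' : ℝ) ≤ Qm := by exact_mod_cast hQm _ _ _ _
        linarith
    simp only [Q]
    linarith
  intro w
  have hred : w.toWord.IsChain (fun l l' => l.1 = l'.1 → l.2 = l'.2) :=
    FreeGroup.isReduced_toWord
  have hprod : FreeGroup.lift (fun i => x i * v ^ M * (x i)⁻¹) w = (w.toWord.map f).prod := by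
    conv_lhs => rw [← FreeGroup.mk_toWord (x := w)]
    rw [FreeGroup.lift_mk]
  rw [hprod, FreeGroup.norm]
  cases hL : w.toWord with
  | nil => simp [H.self]
  | cons l L =>
    rw [hL] at hred
    have := (H.local_global f _ Q hr hQ0 hD L l hred).1
    rw [List.length_cons]
    push_cast
    exact this
end HypS3

theorem orbitD {G : Type*} [Group G] {Y : Type*} [MetricSpace Y] (σ : G →* (Y ≃ᵢ Y)) (y : Y)
    {δ : ℝ} (h0 : 0 ≤ δ) (h : GromovHyperbolic Y δ) :
    HypD (fun a b : G => dist (σ a y) (σ b y)) δ := by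
  refine ⟨fun a => dist_self _, fun a b => dist_comm _ _, fun a b c => dist_triangle _ _ _, ?_, h0,
    fun a b c e => h _ _ _ _⟩
  intro g a b
  have e : ∀ c, σ (g * c) y = σ g (σ c y) := by intro c; rw [map_mul]; rfl
  simp only [e]
  exact (σ g).isometry.dist_eq _ _

theorem exists_axis {G : Type*} [Group G] {d : G → G → ℝ} {δ : ℝ} (H : HypD d δ) (w : G) {a C : ℝ}
    (ha : 0 < a) (h : ∀ n : ℕ, a * n - C ≤ d 1 (w ^ n))
    (hw : ∀ R : ℝ, ∃ N : ℕ, Set.Finite {h : G | d 1 h ≤ R ∧ d (w ^ N) (h * w ^ N) ≤ R}) :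
    ∃ u C', Axis d u C' := by
  obtain ⟨k, hk, hk'⟩ := H.exists_pow w ha h
  obtain ⟨C', h1, h2⟩ := H.exists_axis1 _ hk'
  exact ⟨w ^ k, C', h1, h2, H.wpd_pow w k hk hw⟩

open Classical in
theorem exists_free {G : Type u} [Group G] {d : G → G → ℝ} {δ : ℝ} (H : HypD d δ) {u : G} {C : ℝ}
    (hu : Axis d u C) {S : Set G} (hS : S.Finite) (hSc : Subgroup.closure S = ⊤)
    (hnvc : ¬ VirtuallyCyclic G) :
    ∃ (X : Type u) (_ : Finite X) (φ : FreeGroup X →* G) (i j : X), i ≠ j ∧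
      (∀ w : FreeGroup X, (w.norm : ℝ) ≤ d 1 (φ w)) ∧
      ∀ s ∈ S, ∃ a b : X, a ≠ b ∧
      (φ (FreeGroup.of a) = s * φ (FreeGroup.of i) * s⁻¹ ∨
        φ (FreeGroup.of a) = (s * φ (FreeGroup.of i) * s⁻¹)⁻¹) ∧
      (φ (FreeGroup.of b) = s * φ (FreeGroup.of j) * s⁻¹ ∨
        φ (FreeGroup.of b) = (s * φ (FreeGroup.of j) * s⁻¹)⁻¹) := by
  obtain ⟨t, ht⟩ := H.exists_notE hu hS hSc hnvc
  let B : Set G := {1, t} ∪ (S ∪ (fun s => s * t) '' S)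
  have hB : B.Finite := (Set.toFinite _).union (hS.union (hS.image _))
  let q : G → G ⧸ Esub u := fun g => (g : G ⧸ Esub u)
  let e : G → G := fun g => g⁻¹ * (q g).out
  have heE : ∀ g, e g ∈ Eset u := by
    intro g
    have : ((q g).out : G ⧸ Esub u) = (g : G ⧸ Esub u) := QuotientGroup.out_eq' _
    exact QuotientGroup.eq.1 this.symm
  obtain ⟨n, hn, hne⟩ := H.Ecommon hu (hB.image e) (by rintro _ ⟨g, _, rfl⟩; exact heE g)
  have hv := hu.pow H n hn
  have hsub : ∀ g, g ∈ Eset (u ^ n) → g ∈ Eset u := by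
    rintro g ⟨p, r, hp, hr, h⟩
    have hn' : (n : ℤ) ≠ 0 := by exact_mod_cast hn.ne'
    refine ⟨n * p, n * r, mul_ne_zero hn' hp, mul_ne_zero hn' hr, ?_⟩
    rw [zpow_mul, zpow_mul, zpow_natCast]; exact h
  let X := ↥(q '' B)
  have hX : Finite X := (hB.image q).to_subtype
  obtain ⟨M, hM, hn1⟩ := H.schottky hv (X := X) (fun i => i.1.out) (by
    intro i j hij h
    have h1 : i.1.out⁻¹ * j.1.out ∈ Esub u := hsub _ h
    have h2 := QuotientGroup.eq.2 h1
    rw [QuotientGroup.out_eq', QuotientGroup.out_eq'] at h2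
    exact hij (Subtype.ext h2))
  let m : ∀ g, g ∈ B → X := fun g hg => ⟨q g, g, hg, rfl⟩
  set φ : FreeGroup X →* G := FreeGroup.lift (fun i : X => i.1.out * (u ^ n) ^ M * (i.1.out)⁻¹) with hφ
  have key : ∀ g (hg : g ∈ B), φ (FreeGroup.of (m g hg)) = g * (u ^ n) ^ M * g⁻¹ ∨
      φ (FreeGroup.of (m g hg)) = (g * (u ^ n) ^ M * g⁻¹)⁻¹ := by
    intro g hg
    have e1 : φ (FreeGroup.of (m g hg)) = g * (e g * u ^ n * (e g)⁻¹) ^ M * g⁻¹ := by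
      rw [hφ, FreeGroup.lift_apply_of, conj_pow]
      simp only [e, m]
      group
    rw [e1]
    rcases hne _ ⟨g, hg, rfl⟩ with h | h
    · left; rw [h]
    · right; rw [h]; group
  have mk : ∀ g g' (hg : g ∈ B) (hg' : g' ∈ B), g⁻¹ * g' ∉ Eset u → m g hg ≠ m g' hg' := by
    intro g g' hg hg' h h'
    exact h (QuotientGroup.eq.1 (congrArg Subtype.val h'))
  have b1 : (1 : G) ∈ B := Or.inl (Or.inl rfl)
  have bt : t ∈ B := Or.inl (Or.inr rfl)
  refine ⟨X, hX, φ, m 1 b1, m t bt, mk 1 t b1 bt (by simpa using ht), hn1, ?_⟩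
  intro s hs
  have bs : s ∈ B := Or.inr (Or.inl hs)
  have bst : s * t ∈ B := Or.inr (Or.inr ⟨s, hs, rfl⟩)
  refine ⟨m s bs, m (s * t) bst, mk s (s * t) bs bst (by simpa using ht), ?_, ?_⟩
  · rcases key s bs with h | h <;> rcases key 1 b1 with h' | h' <;> rw [h, h']
    · left; group
    · right; group
    · right; group
    · left; group
  · rcases key (s * t) bst with h | h <;> rcases key t bt with h' | h' <;> rw [h, h']
    · left; group
    · right; group
    · right; group
    · left; group

open Classical in
theorem nowhere_aux (G : Type u) [Group G] (hfg : Group.FG G)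
    (hnvc : ¬ VirtuallyCyclic G) (P : Set (Subgroup G))
    (Y : Type u) [MetricSpace Y] (σ : G →* (Y ≃ᵢ Y))
    (hY : HyperbolicGeodesicSpace Y) (g : G) (hg : IsWPD σ g)
    (hP : ∀ p ∈ P, ∀ y : Y, Bornology.IsBounded ((fun h : G => σ h y) '' (p : Set G))) :
    ∃ g : G, NowhereEllipticZP P g := by
  obtain ⟨_, δ, h0, hδ⟩ := hY
  obtain ⟨⟨y, a, b, C, ha, hl⟩, hw⟩ := hg
  have H := orbitD σ y h0 hδ
  obtain ⟨u, C', hu⟩ := exists_axis H g (a := a) (C := C) ha (by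
    intro n
    have := (hl 0 n).1
    simpa using this) (by
    intro R
    obtain ⟨N, hN⟩ := hw (|R| + 1) (by positivity) y
    refine ⟨N, hN.subset ?_⟩
    rintro h ⟨h1, h2⟩
    have hR := le_abs_self R
    have e1 : σ (1 : G) y = y := by rw [map_one]; rfl
    have e2 : σ (h * g ^ N) y = σ h (σ (g ^ N) y) := by rw [map_mul]; rfl
    simp only [e1, e2] at h1 h2
    exact ⟨by linarith, by linarith⟩)
  obtain ⟨S, hSc, hS⟩ := Group.fg_iff.1 hfg
  obtain ⟨X, hX, φ, i, j, hij, hn, hSj⟩ := exists_free H hu hS hSc hnvc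
  have e1 : σ (1 : G) y = y := by rw [map_one]; rfl
  simp only [e1] at hn
  have hfin : (Set.range (fun a : X => FreeGroup.of a) ∪
      (fun p : X × X => FreeGroup.of p.1 * FreeGroup.of p.2) '' {p | p.1 ≠ p.2}).Finite :=
    (Set.finite_range _).union ((Set.toFinite _).image _)
  obtain ⟨w, hw1, hww⟩ := comb_list.{u} hfin.toFinset.toList (by
    intro a ha
    rw [Finset.mem_toList, Set.Finite.mem_toFinset] at ha
    rcases ha with ⟨a, rfl⟩ | ⟨⟨a, b⟩, hab, rfl⟩
    · exact FreeGroup.of_ne_one a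
    · intro h
      refine free_of_pow (n := 1) (m := -1) hab one_ne_zero ?_
      rw [zpow_one, zpow_neg_one]
      exact eq_inv_of_mul_eq_one_left h) (FreeGroup.of i) (FreeGroup.of_ne_one i)
  refine ⟨φ w, ?_⟩
  rintro T _ ρ hT hnf harc ⟨x, hx⟩
  have hyp := tree_hyp hT
  have ga := good_arc ρ φ P σ hP y hn harc
  refine hww T _ (ρ.comp φ) hyp hT.1 ga ?_ x hx
  by_contra hcon
  push Not at hcon
  refine tree_step hyp hT.1 ρ φ ga S hSc i j hij hSj hnf ?_ ?_
  · intro a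
    refine hcon _ ?_
    rw [Finset.mem_toList, Set.Finite.mem_toFinset]
    exact Or.inl ⟨a, rfl⟩
  · intro a b hab
    refine hcon _ ?_
    rw [Finset.mem_toList, Set.Finite.mem_toFinset]
    exact Or.inr ⟨(a, b), hab, rfl⟩

/-- If a finitely generated group `G` which is not virtually cyclic admits an isometric
action on a hyperbolic space with a WPD element in which every subgroup of the
collection `P` has bounded orbits, then `G` contains an element which is nowhere
elliptic in `𝒵𝒫`-trees. -/
theorem exists_nowhereElliptic (G : Type u) [Group G] (hfg : Group.FG G)
    (hnvc : ¬ VirtuallyCyclic G) (P : Set (Subgroup G))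
    (hact : ∃ (Y : Type u) (_ : MetricSpace Y) (σ : G →* (Y ≃ᵢ Y)),
      HyperbolicGeodesicSpace Y ∧ (∃ g : G, IsWPD σ g) ∧
      ∀ p ∈ P, ∀ y : Y, Bornology.IsBounded ((fun h : G => σ h y) '' (p : Set G))) :
    ∃ g : G, NowhereEllipticZP P g := by
  obtain ⟨Y, _, σ, hY, ⟨g, hg⟩, hP⟩ := hact
  exact nowhere_aux G hfg hnvc P Y σ hY g hg hP
end
end
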